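/- Let M and M' be GF(4)-representable matroids such that M is connected, M' is 3-connected, and M' is obtained from M by relaxing a circuit-hyperplane X. Then M' is either U_{2,4}-fragile or {U_{2,5}, U_{3,5}}-fragile. Moreover, X is a basis of M' every element of which is nondeletable in M', and every element of E(M')−X is noncontractible in M'. -/

import Mathlib

open Matroid Set
open scoped Classical

namespace Relax

variable {α β : Type*}

/-- A circuit of a matroid: a minimal dependent set. -/
def Circuit (M : Matroid α) (C : Set α) : Prop :=
  M.Dep C ∧ ∀ D ⊂ C, M.Indep D

/-- A hyperplane of a matroid: a maximal proper flat. -/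
def Hyperplane (M : Matroid α) (H : Set α) : Prop :=
  M.IsFlat H ∧ H ≠ M.E ∧ ∀ F, M.IsFlat F → H ⊂ F → F = M.E

/-- `X` is a circuit-hyperplane of `M`. -/
def CircuitHyperplane (M : Matroid α) (X : Set α) : Prop :=
  Circuit M X ∧ Hyperplane M X

/-- `M'` is obtained from `M` by relaxing the circuit-hyperplane `X` : the ground set is
unchanged and the bases of `M'` are exactly the bases of `M` together with `X`. -/
def IsRelaxation (M M' : Matroid α) (X : Set α) : Prop :=
  CircuitHyperplane M X ∧ M'.E = M.E ∧ ∀ B, (M'.IsBase B ↔ M.IsBase B ∨ B = X)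

/-- A matroid is representable over a field `F` if there is an assignment of vectors to its
elements under which independence coincides with linear independence. -/
def Representable (M : Matroid α) (F : Type*) [Field F] : Prop :=
  ∃ (n : ℕ) (φ : α → (Fin n → F)), ∀ I ⊆ M.E,
    (M.Indep I ↔ LinearIndependent F (fun x : I => φ (x : α)))

/-- The field GF(4). -/
abbrev GF4 := GaloisField 2 2

/-- The rank of a set in a matroid: the maximum size of an independent subset. -/
noncomputable def rk (M : Matroid α) (X : Set α) : ℕ :=
  sSup {n | ∃ I, M.Indep I ∧ I ⊆ X ∧ I.ncard = n}

/-- Deletion of a set of elements. -/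
def delete (M : Matroid α) (D : Set α) : Matroid α := M ↾ (M.E \ D)

/-- Contraction of a set of elements. -/
def contract (M : Matroid α) (C : Set α) : Matroid α := (delete M✶ C)✶

/-- `N` is a minor of `M`. -/
def MinorOf (N M : Matroid α) : Prop :=
  ∃ C D, C ⊆ M.E ∧ D ⊆ M.E ∧ Disjoint C D ∧ N = delete (contract M C) D

/-- Isomorphism of matroids. -/
def Iso (M : Matroid α) (N : Matroid β) : Prop :=
  ∃ e : M.E ≃ N.E, ∀ I : Set M.E,
    M.Indep ((↑) '' I) ↔ N.Indep ((↑) '' (e '' I))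

/-- `M` has a minor isomorphic to `N`. -/
def HasMinorIso (M : Matroid α) (N : Matroid β) : Prop :=
  ∃ M₀ : Matroid α, MinorOf M₀ M ∧ Iso M₀ N

/-- `M` has a minor isomorphic to a member of the set `𝒩` of matroids. -/
def HasMinorIn (M : Matroid α) (𝒩 : Set (Matroid β)) : Prop :=
  ∃ N ∈ 𝒩, HasMinorIso M N

/-- `M` is `𝒩`-fragile. -/
def Fragile (M : Matroid α) (𝒩 : Set (Matroid β)) : Prop :=
  HasMinorIn M 𝒩 ∧
    ∀ a ∈ M.E, ¬ (HasMinorIn (delete M {a}) 𝒩 ∧ HasMinorIn (contract M {a}) 𝒩)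

/-- `M` is (isomorphic to) the uniform matroid `U_{r,n}`. -/
def IsUniform (M : Matroid α) (r n : ℕ) : Prop :=
  M.E.Finite ∧ M.E.ncard = n ∧ ∀ I ⊆ M.E, (M.Indep I ↔ I.ncard ≤ r)

/-- `M` has a minor isomorphic to `U_{r,n}`. -/
def HasUnifMinor (M : Matroid α) (r n : ℕ) : Prop :=
  ∃ M₀, MinorOf M₀ M ∧ IsUniform M₀ r n

/-- `M` has a `{U_{2,5}, U_{3,5}}`-minor. -/
def HasU25U35Minor (M : Matroid α) : Prop :=
  HasUnifMinor M 2 5 ∨ HasUnifMinor M 3 5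

/-- `M` is `U_{2,4}`-fragile. -/
def FragileU24 (M : Matroid α) : Prop :=
  HasUnifMinor M 2 4 ∧
    ∀ a ∈ M.E, ¬ (HasUnifMinor (delete M {a}) 2 4 ∧ HasUnifMinor (contract M {a}) 2 4)

/-- `M` is `{U_{2,5}, U_{3,5}}`-fragile. -/
def FragileU25U35 (M : Matroid α) : Prop :=
  HasU25U35Minor M ∧
    ∀ a ∈ M.E, ¬ (HasU25U35Minor (delete M {a}) ∧ HasU25U35Minor (contract M {a}))

/-- A loop. -/
def Loop (M : Matroid α) (x : α) : Prop := x ∈ M.E ∧ ¬ M.Indep {x}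

/-- Two distinct non-loop elements are parallel if they form a two-element circuit. -/
def Parallel (M : Matroid α) (x y : α) : Prop := x ≠ y ∧ Circuit M {x, y}

/-- A parallel class: a maximal set of pairwise-parallel non-loop elements. -/
def ParallelClass (M : Matroid α) (A : Set α) : Prop :=
  A ⊆ M.E ∧ (∀ x ∈ A, ¬ Loop M x) ∧
    (∀ x ∈ A, ∀ y ∈ A, x ≠ y → Parallel M x y) ∧
    (∀ B, A ⊆ B → B ⊆ M.E → (∀ x ∈ B, ¬ Loop M x) →
      (∀ x ∈ B, ∀ y ∈ B, x ≠ y → Parallel M x y) → B = A)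

/-- A series class: a parallel class of the dual. -/
def SeriesClass (M : Matroid α) (A : Set α) : Prop := ParallelClass M✶ A

/-- A matroid is connected if every two distinct elements lie in a common circuit. -/
def Connected (M : Matroid α) : Prop :=
  ∀ x ∈ M.E, ∀ y ∈ M.E, x ≠ y → ∃ C, Circuit M C ∧ x ∈ C ∧ y ∈ C

/-- A `k`-separation of `M`. -/
def Separation (M : Matroid α) (k : ℕ) (A B : Set α) : Prop :=
  A ∪ B = M.E ∧ Disjoint A B ∧ k ≤ A.ncard ∧ k ≤ B.ncard ∧
    rk M A + rk M B ≤ rk M M.E + (k - 1)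

/-- A matroid is 3-connected if it is connected and has no 2-separation. -/
def ThreeConnected (M : Matroid α) : Prop :=
  Connected M ∧ ∀ A B, ¬ Separation M 2 A B

/-- `M` is 3-connected up to series and parallel classes. -/
def ThreeConnUpToSP (M : Matroid α) : Prop :=
  Connected M ∧ ∀ A B, Separation M 2 A B →
    (SeriesClass M A ∨ ParallelClass M A ∨ SeriesClass M B ∨ ParallelClass M B)

/-- A 3-separating set of `M`. -/
def ThreeSeparating (M : Matroid α) (Y : Set α) : Prop :=
  Y ⊆ M.E ∧ rk M Y + rk M (M.E \ Y) ≤ rk M M.E + 2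

/-- `M` has path width 3: there is an ordering of the ground set all of whose initial
segments are 3-separating. -/
def PathWidth3 (M : Matroid α) : Prop :=
  ∃ (n : ℕ) (e : Fin n → α), Function.Injective e ∧ Set.range e = M.E ∧
    ∀ t : Fin n, ThreeSeparating M (e '' {i | i ≤ t})

/-- A segment: every 3-element subset is a triangle. -/
def Segment (M : Matroid α) (S : Set α) : Prop :=
  S ⊆ M.E ∧ ∀ T ⊆ S, T.ncard = 3 → Circuit M T

/-- A triangle: a 3-element circuit. -/
def Triangle (M : Matroid α) (S : Set α) : Prop := Circuit M S ∧ S.ncard = 3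

/-! ### Reduced representations `[I | C]` with `C = [[A, 1], [1ᵀ, w]]` -/

/-- The column, indexed by `x`, of the matrix `[I | C]` whose rows are indexed by
`(X \ {e}) ∪ {f}`, where `C` is the block matrix `[[A, 1], [1ᵀ, w]]` with row block `X \ {e}`,
column block `(E \ X) \ {f}`, last column `e`, last row `f`, and corner entry `w`. -/
noncomputable def colVec (X : Set α) (e f : α) (A : α → α → GF4) (w : GF4) :
    α → ((X \ {e} ∪ {f} : Set α) → GF4) := fun x r =>
  if x ∈ X \ {e} ∪ ({f} : Set α) then (if (r : α) = x then 1 else 0)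
  else if (r : α) = f then (if x = e then w else 1)
  else if x = e then 1 else A (r : α) x

/-- `M = M[I | C]` where `C` is the block matrix `[[A, 1], [1ᵀ, w]]` relative to the
basis `(X \ {e}) ∪ {f}`. -/
def RepBy (M : Matroid α) (X : Set α) (e f : α) (A : α → α → GF4) (w : GF4) : Prop :=
  ∀ I ⊆ M.E, (M.Indep I ↔
    LinearIndependent GF4 (fun x : I => colVec X e f A w (x : α)))

/-- The matrix `B`, with rows restricted to `R` and columns restricted to `K`, has an
`m × n` submatrix (up to permuting rows and columns) equal to the pattern `P`. -/
def HasPattern {m n : ℕ} (B : α → α → GF4) (R K : Set α) (P : Fin m → Fin n → GF4) : Prop :=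
  ∃ (r : Fin m → α) (c : Fin n → α), Function.Injective r ∧ Function.Injective c ∧
    (∀ i, r i ∈ R) ∧ (∀ j, c j ∈ K) ∧ ∀ i j, B (r i) (c j) = P i j

/-- One non-zero element of GF(4). -/
def NZ1 (x : GF4) : Prop := x ≠ 0

/-- Two distinct non-zero elements of GF(4). -/
def NZ2 (x y : GF4) : Prop := x ≠ 0 ∧ y ≠ 0 ∧ x ≠ y

/-- Three distinct non-zero elements of GF(4). -/
def NZ3 (x y z : GF4) : Prop :=
  x ≠ 0 ∧ y ≠ 0 ∧ z ≠ 0 ∧ x ≠ y ∧ x ≠ z ∧ y ≠ z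

/-- `B` (with rows from `R` and columns from `K`) contains one of the fifteen forbidden
submatrices, up to permuting rows and columns, where `x, y, z` denote distinct non-zero
elements of GF(4). -/
def HasForbidden (B : α → α → GF4) (R K : Set α) : Prop :=
  (∃ x y z, NZ3 x y z ∧ HasPattern B R K ![![x, y, z]]) ∨
  (∃ x y, NZ2 x y ∧ HasPattern B R K ![![x, y], ![0, x]]) ∨
  (∃ x y, NZ2 x y ∧ HasPattern B R K ![![x, y], ![y, x]]) ∨
  (∃ x y z, NZ3 x y z ∧ HasPattern B R K ![![x, y], ![z, x]]) ∨
  (∃ x y z, NZ3 x y z ∧ HasPattern B R K ![![x, x], ![y, z]]) ∨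
  (∃ x, NZ1 x ∧ HasPattern B R K ![![x, x, 0], ![x, 0, x]]) ∨
  (∃ x y, NZ2 x y ∧ HasPattern B R K ![![x, x, 0], ![x, 0, y]]) ∨
  (∃ x y, NZ2 x y ∧ HasPattern B R K ![![x, x, 0], ![y, 0, y]]) ∨
  (∃ x y, NZ2 x y ∧ HasPattern B R K ![![x, y, 0], ![x, 0, y]]) ∨
  (∃ x y z, NZ3 x y z ∧ HasPattern B R K ![![x, 0, 0], ![0, y, z]]) ∨
  (∃ x, NZ1 x ∧ HasPattern B R K ![![x, 0, 0], ![0, x, 0], ![0, 0, x]]) ∨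
  (∃ x y, NZ2 x y ∧ HasPattern B R K ![![x, 0, 0], ![0, x, 0], ![0, 0, y]]) ∨
  (∃ x y z, NZ3 x y z ∧ HasPattern B R K ![![x, 0, 0], ![0, y, 0], ![0, 0, z]]) ∨
  (∃ x y, NZ2 x y ∧ HasPattern B R K ![![x, y, x], ![y, y, 0], ![x, 0, 0]]) ∨
  (∃ x y z, NZ3 x y z ∧ HasPattern B R K ![![x, y, x], ![y, y, 0], ![x, 0, z]])

/-! ### The matroids `P₈⁻`, `F₇⁼` and its dual -/

/-- The columns of the GF(3)-matrix `[I₄ | A]` representing `P₈`, where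
`A = [[0,1,1,-1],[1,0,1,1],[1,1,0,1],[-1,1,1,0]]`. -/
def P8cols : Fin 8 → Fin 4 → ZMod 3 :=
  ![![1, 0, 0, 0], ![0, 1, 0, 0], ![0, 0, 1, 0], ![0, 0, 0, 1],
    ![0, 1, 1, -1], ![1, 0, 1, 1], ![1, 1, 0, 1], ![-1, 1, 1, 0]]

/-- `M` is isomorphic to `P₈`. -/
def IsP8 (M : Matroid α) : Prop :=
  ∃ g : α → Fin 8, Set.BijOn g M.E Set.univ ∧
    ∀ I ⊆ M.E, (M.Indep I ↔ LinearIndependent (ZMod 3) (fun x : I => P8cols (g (x : α))))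

/-- `M` is isomorphic to `P₈⁻`: it is obtained from a copy of `P₈` by relaxing one of its
pair of disjoint circuit-hyperplanes. -/
def IsP8Minus (M : Matroid α) : Prop :=
  ∃ (N : Matroid α) (X Y : Set α), IsP8 N ∧ CircuitHyperplane N Y ∧ Disjoint X Y ∧
    IsRelaxation N M X

/-- The columns of the rational matrix representing the non-Fano matroid `F₇⁻`: the seven
non-zero `{0,1}`-vectors of length 3. -/
def F7cols : Fin 7 → Fin 3 → ℚ :=
  ![![1, 0, 0], ![0, 1, 0], ![0, 0, 1], ![1, 1, 0], ![1, 0, 1], ![0, 1, 1], ![1, 1, 1]]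

/-- `M` is isomorphic to the non-Fano matroid `F₇⁻`. -/
def IsF7Minus (M : Matroid α) : Prop :=
  ∃ g : α → Fin 7, Set.BijOn g M.E Set.univ ∧
    ∀ I ⊆ M.E, (M.Indep I ↔ LinearIndependent ℚ (fun x : I => F7cols (g (x : α))))

/-- `M` is isomorphic to `F₇⁼`: it is obtained from a copy of `F₇⁻` by relaxing a
circuit-hyperplane. -/
def IsF7Eq (M : Matroid α) : Prop :=
  ∃ (N : Matroid α) (X : Set α), IsF7Minus N ∧ IsRelaxation N M X

end Relax

namespace Relax

variable {α F : Type*} [Field F]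

/-- The matroid `N` is represented by the space `L` of linear dependencies among its elements. -/
def IsRelationSpace (N : Matroid α) (L : Submodule F (α → F)) : Prop :=
  ∀ I ⊆ N.E, (N.Indep I ↔ ∀ w ∈ L, (∀ e ∉ I, w e = 0) → w = 0)

/-- Representability over `F`, phrased through spaces of linear dependencies. -/
def HasRelationSpace (N : Matroid α) (F : Type*) [Field F] : Prop :=
  ∃ L : Submodule F (α → F), IsRelationSpace N L

/-- `N` is represented by the matrix `[I | P]` with rows `B` and columns `B ∪ Y`. -/
def MulRep (N : Matroid α) (B Y : Finset α) (P : α → α → F) : Prop :=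
  ∀ I ⊆ (B ∪ Y : Set α), (N.Indep I ↔ ∀ w : α → F, (∀ e ∉ I, w e = 0) →
    (∀ b ∈ B, w b = ∑ y ∈ Y, w y * P b y) → w = 0)

/-- `N` is represented by the vectors `(eₓ, 0)` for `x ∈ X` and `(q_y, 1)` for `y ∈ Y`
in the space `(F ^ X / ⟨1⟩) × F`. -/
def AddRep (N : Matroid α) (X Y : Finset α) (q : α → α → F) : Prop :=
  ∀ I ⊆ (X ∪ Y : Set α), (N.Indep I ↔ ∀ (w : α → F) (k : F), (∀ e ∉ I, w e = 0) →
    ∑ y ∈ Y, w y = 0 → (∀ x ∈ X, w x + ∑ y ∈ Y, w y * q x y = k) → w = 0)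

/-- `B` is a basis of `N`, and exchanging any element of `B` for any element of `Y` gives an
independent set. -/
def FullBase (N : Matroid α) (B Y : Finset α) : Prop :=
  N.Indep B ∧ ∀ y ∈ Y, ¬ N.Indep (insert y B) ∧ ∀ b ∈ B, N.Indep (insert y (B \ {b}))

/-- `X` is dependent, and exchanging any element of `X` for any element of `Y` gives a basis. -/
def CHyp (N : Matroid α) (X Y : Finset α) : Prop :=
  ¬ N.Indep X ∧ ∀ x ∈ X, ∀ y ∈ Y, N.IsBase (insert y (X \ {x}))

theorem hasRelationSpace_of_representable {N : Matroid α} (hfin : N.E.Finite)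
    (h : Representable N F) : HasRelationSpace N F := by
  obtain ⟨n, φ, hφ⟩ := h
  let E := hfin.toFinset
  refine ⟨LinearMap.ker (∑ e ∈ E, (LinearMap.proj e : (α → F) →ₗ[F] F).smulRight (φ e)), ?_⟩
  intro I hI
  rw [hφ I hI]
  have hIf : I.Finite := hfin.subset hI
  change LinearIndepOn F φ I ↔ _
  have hsum : ∀ w : α → F, (∀ e ∉ I, w e = 0) →
      ∑ e ∈ E, w e • φ e = ∑ e ∈ hIf.toFinset, w e • φ e := by
    intro w hw
    symm
    apply Finset.sum_subset
    · intro x hx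
      simpa [E] using hI (by simpa using hx)
    · intro x _ hx
      rw [hw x (by simpa using hx), zero_smul]
  rw [show I = (hIf.toFinset : Set α) by simp, linearIndepOn_finset_iff]
  constructor
  · intro h w hwL hw
    have hw' : ∀ e ∉ I, w e = 0 := by simpa using hw
    have : ∑ e ∈ E, w e • φ e = 0 := by simpa [LinearMap.sum_apply] using hwL
    rw [hsum w hw'] at this
    funext e
    by_cases he : e ∈ I
    · exact h w this e (by simpa using he)
    · exact hw' e he
  · intro h w hw e he
    let v : α → F := fun e => if e ∈ I then w e else 0
    have hv : ∀ e ∉ I, v e = 0 := fun e he => if_neg he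
    have : v = 0 := by
      apply h v
      · simp only [LinearMap.mem_ker, LinearMap.sum_apply, LinearMap.smulRight_apply,
          LinearMap.proj_apply]
        rw [hsum v hv, ← hw]
        refine Finset.sum_congr rfl fun x hx => ?_
        have : x ∈ I := by simpa using hx
        simp [v, this]
      · simpa using hv
    have h2 := congrFun this e
    have : e ∈ I := by simpa using he
    simpa [v, this] using h2

theorem HasRelationSpace.restrict {N : Matroid α} (h : HasRelationSpace N F) {R : Set α}
    (hR : R ⊆ N.E) : HasRelationSpace (N ↾ R) F := by
  obtain ⟨L, hL⟩ := h
  refine ⟨L, fun I hI => ?_⟩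
  rw [restrict_ground_eq] at hI
  rw [restrict_indep_iff, hL I (hI.trans hR)]
  simp [hI]

theorem HasRelationSpace.contract_indep {N : Matroid α} (h : HasRelationSpace N F) {C : Set α}
    (hC : N.Indep C) : HasRelationSpace (N ／ C) F := by
  obtain ⟨L, hL⟩ := h
  let π : (α → F) →ₗ[F] (α → F) :=
    { toFun := fun w e => if e ∈ C then 0 else w e
      map_add' := by intro v w; funext e; by_cases he : e ∈ C <;> simp [he]
      map_smul' := by intro c w; funext e; by_cases he : e ∈ C <;> simp [he] }
  have hπ : ∀ w e, π w e = if e ∈ C then 0 else w e := fun _ _ => rfl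
  have hC' := (hL C hC.subset_ground).1 hC
  refine ⟨L.map π, fun I hI => ?_⟩
  rw [contract_ground, subset_sdiff] at hI
  rw [hC.contract_indep_iff, hL _ (union_subset hI.1 hC.subset_ground)]
  constructor
  · rintro ⟨-, h⟩ _ ⟨w, hw, rfl⟩ hw0
    rw [h w hw ?_, map_zero]
    intro e he
    rw [mem_union, not_or] at he
    simpa [hπ, he.2] using hw0 e he.1
  · refine fun h => ⟨hI.2, fun w hw hw0 => hC' w hw fun e he => ?_⟩
    have := h (π w) (Submodule.mem_map_of_mem hw) (fun e he => ?_)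
    · simpa [hπ, he] using congrFun this e
    · rw [hπ]
      split_ifs with h1
      · rfl
      · exact hw0 e (by simp [he, h1])

theorem HasRelationSpace.contract {N : Matroid α} (h : HasRelationSpace N F) {C : Set α}
    (hC : C ⊆ N.E) : HasRelationSpace (N ／ C) F := by
  obtain ⟨I, hI⟩ := N.exists_isBasis C
  rw [hI.contract_eq_contract_delete, delete_eq_restrict]
  exact (h.contract_indep hI.indep).restrict sdiff_subset

theorem HasRelationSpace.minor {N N₀ : Matroid α} (h : HasRelationSpace N F)
    (h0 : MinorOf N₀ N) : HasRelationSpace N₀ F := by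
  obtain ⟨C, D, hC, -, -, rfl⟩ := h0
  exact (h.contract hC).restrict sdiff_subset

end Relax

namespace Relax

variable {α F : Type*} [Field F]

theorem exists_mulRep {N : Matroid α} {B Y : Finset α} (hE : N.E = (B : Set α) ∪ Y)
    (hd : Disjoint B Y)
    (h : HasRelationSpace N F) (hB : FullBase N B Y) :
    ∃ P : α → α → F, (∀ b ∈ B, ∀ y ∈ Y, P b y ≠ 0) ∧ MulRep N B Y P := by
  obtain ⟨L, hL⟩ := h
  have hdY : ∀ y ∈ Y, y ∉ B := fun y hy hyB => Finset.disjoint_left.1 hd hyB hy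
  have hBE : (B : Set α) ⊆ N.E := by rw [hE]; exact subset_union_left
  have hBi := (hL B hBE).1 hB.1
  have key : ∀ y ∈ Y, ∃ v ∈ L, (∀ e, e ≠ y → e ∉ B → v e = 0) ∧ v y = 1 := by
    intro y hy
    have hyE : insert y (B : Set α) ⊆ N.E := insert_subset (by rw [hE]; exact Or.inr hy) hBE
    have h1 := (hB.2 y hy).1
    rw [hL _ hyE] at h1
    push Not at h1
    obtain ⟨v, hvL, hv, hv0⟩ := h1
    have hvy : v y ≠ 0 := by
      intro h0
      refine hv0 (hBi v hvL fun e he => ?_)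
      by_cases hey : e = y
      · rw [hey, h0]
      · exact hv e (by simp [hey]; simpa using he)
    refine ⟨(v y)⁻¹ • v, L.smul_mem _ hvL, fun e hey heB => ?_, by simp [hvy]⟩
    simp [hv e (by simp [hey, heB])]
  choose! v hvL hv hv1 using key
  refine ⟨fun b y => v y b, fun b hb y hy h0 => ?_, fun I hI => ?_⟩
  · have h1 := (hL _ ((hB.2 y hy).2 b hb).subset_ground).1 ((hB.2 y hy).2 b hb) (v y) (hvL y hy)
      (fun e he => ?_)
    · have := hv1 y hy
      rw [h1] at this
      simp at this
    · rw [mem_insert_iff, not_or] at he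
      by_cases heb : e = b
      · rw [heb]; exact h0
      · exact hv y hy e he.1 (fun h => he.2 ⟨h, heb⟩)
  · rw [hL I (by rwa [hE])]
    have main : ∀ w : α → F, (∀ e ∉ I, w e = 0) →
        (w ∈ L ↔ ∀ b ∈ B, w b = ∑ y ∈ Y, w y * v y b) := by
      intro w hw
      have hS : ∑ y ∈ Y, w y • v y ∈ L :=
        L.sum_mem fun y hy => L.smul_mem _ (hvL y hy)
      have hoff : ∀ e ∉ B, (w - ∑ y ∈ Y, w y • v y) e = 0 := by
        intro e heB
        simp only [Pi.sub_apply, Finset.sum_apply, Pi.smul_apply, smul_eq_mul]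
        by_cases heY : e ∈ Y
        · rw [Finset.sum_eq_single_of_mem e heY, hv1 e heY, mul_one, sub_self]
          intro y hy hne
          rw [hv y hy e hne.symm heB, mul_zero]
        · rw [hw e (fun h => (hI h).elim heB heY), Finset.sum_eq_zero, sub_zero]
          intro y hy
          rw [hv y hy e (fun h => heY (h ▸ hy)) heB, mul_zero]
      constructor
      · intro hwL b hb
        have := congrFun (hBi _ (L.sub_mem hwL hS) (by simpa using hoff)) b
        simpa [sub_eq_zero] using this
      · intro hb
        have : w - ∑ y ∈ Y, w y • v y = 0 := by
          funext e
          by_cases he : e ∈ B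
          · simpa [sub_eq_zero] using hb e he
          · exact hoff e he
        rw [sub_eq_zero.1 this]
        exact hS
    constructor
    · exact fun h w hw hb => h w ((main w hw).2 hb) hw
    · exact fun h w hwL hw => h w hw ((main w hw).1 hwL)

theorem exists_addRep {N : Matroid α} {X Y : Finset α} (hE : N.E = (X : Set α) ∪ Y)
    (hd : Disjoint X Y)
    (hX : X.Nonempty) (hY : Y.Nonempty)
    (h : HasRelationSpace N F) (hN : CHyp N X Y) :
    ∃ q : α → α → F, AddRep N X Y q := by
  obtain ⟨L, hL⟩ := h
  obtain ⟨x₀, hx₀⟩ := hX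
  obtain ⟨y₀, hy₀⟩ := hY
  have hdY : ∀ y ∈ Y, y ∉ X := fun y hy hyB => Finset.disjoint_left.1 hd hyB hy
  have hXE : (X : Set α) ⊆ N.E := by rw [hE]; exact subset_union_left
  have hxi : ∀ x ∈ X, ∀ w ∈ L, (∀ e, e ≠ y₀ → e ∉ X → w e = 0) → w x = 0 → w = 0 := by
    intro x hx w hwL hw hwx
    refine (hL _ (hN.2 x hx y₀ hy₀).subset_ground).1 (hN.2 x hx y₀ hy₀).indep w hwL fun e he => ?_
    rw [mem_insert_iff, not_or] at he
    by_cases hex : e = x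
    · rw [hex]; exact hwx
    · exact hw e he.1 (fun h => he.2 ⟨h, hex⟩)
  obtain ⟨c, hcL, hcX, hc⟩ : ∃ c ∈ L, (∀ e ∉ X, c e = 0) ∧ ∀ x ∈ X, c x ≠ 0 := by
    have h1 := hN.1
    rw [hL _ hXE] at h1
    push Not at h1
    obtain ⟨c, hcL, hcX, hc0⟩ := h1
    exact ⟨c, hcL, by simpa using hcX, fun x hx h0 =>
      hc0 (hxi x hx c hcL (fun e _ he => hcX e (by simpa using he)) h0)⟩
  have key : ∀ y ∈ Y, ∃ v ∈ L, ∃ t : F, t ≠ 0 ∧ (∀ e, e ∉ X → e ∉ Y → v e = 0) ∧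
      ∀ e ∈ Y, v e = (if e = y then 1 else 0) - (if e = y₀ then t else 0) := by
    intro y hy
    by_cases hyy : y = y₀
    · exact ⟨0, L.zero_mem, 1, one_ne_zero, by simp, by simp [hyy]⟩
    have hb := hN.2 x₀ hx₀ y₀ hy₀
    have hb' := hN.2 x₀ hx₀ y hy
    have hyE : y ∈ N.E := by rw [hE]; exact Or.inr hy
    have hdep : ¬ N.Indep (insert y (insert y₀ ((X : Set α) \ {x₀}))) := by
      intro hi
      have := hb.eq_of_subset_indep hi (subset_insert _ _)
      have hmem : y ∈ insert y₀ ((X : Set α) \ {x₀}) := by rw [this]; exact mem_insert _ _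
      rcases hmem with h | h
      · exact hyy h
      · exact hdY y hy h.1
    rw [hL _ (insert_subset hyE hb.subset_ground)] at hdep
    push Not at hdep
    obtain ⟨v, hvL, hv, hv0⟩ := hdep
    have hvoff : ∀ e, e ∉ X → e ≠ y → e ≠ y₀ → v e = 0 := by
      intro e h1 h2 h3
      exact hv e (by simp [h1, h2, h3])
    have hvx : v x₀ = 0 := by
      apply hv
      have h1 : x₀ ≠ y := fun h => hdY y hy (h ▸ hx₀)
      have h2 : x₀ ≠ y₀ := fun h => hdY y₀ hy₀ (h ▸ hx₀)
      simp [h1, h2]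
    have hvy : v y ≠ 0 := by
      intro h0
      refine hv0 (hxi x₀ hx₀ v hvL (fun e h1 h2 => ?_) hvx)
      by_cases h3 : e = y
      · rw [h3, h0]
      · exact hvoff e h2 h3 h1
    have hvy0 : v y₀ ≠ 0 := by
      intro h0
      refine hv0 ((hL _ hb'.subset_ground).1 hb'.indep v hvL fun e he => ?_)
      rw [mem_insert_iff, not_or] at he
      by_cases h3 : e = y₀
      · rw [h3, h0]
      · by_cases h4 : e = x₀
        · rw [h4, hvx]
        · exact hvoff e (fun h => he.2 ⟨h, h4⟩) he.1 h3
    refine ⟨(v y)⁻¹ • v, L.smul_mem _ hvL, -((v y)⁻¹ * v y₀), by simp [hvy, hvy0], ?_, ?_⟩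
    · intro e h1 h2
      simp [hvoff e h1 (fun h => h2 (h ▸ hy)) (fun h => h2 (h ▸ hy₀))]
    · intro e heY
      by_cases h1 : e = y
      · subst h1
        simp [hyy, hvy]
      · by_cases h2 : e = y₀
        · subst h2
          simp [h1]
        · simp [h1, h2, hvoff e (hdY e heY) h1 h2]
  choose! v hvL t ht hvoff hvY using key
  have main : ∀ w : α → F, (∀ e, e ∉ X → e ∉ Y → w e = 0) →
      (w ∈ L ↔ ∑ y ∈ Y, w y * t y = 0 ∧ ∃ k, ∀ x ∈ X, w x - ∑ y ∈ Y, w y * v y x = k * c x) := by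
    intro w hw
    have hS : ∑ y ∈ Y, w y • v y ∈ L :=
      L.sum_mem fun y hy => L.smul_mem _ (hvL y hy)
    have hoff : ∀ e ∉ X, e ≠ y₀ → (w - ∑ y ∈ Y, w y • v y) e = 0 := by
      intro e heB hne
      simp only [Pi.sub_apply, Finset.sum_apply, Pi.smul_apply, smul_eq_mul]
      by_cases heY : e ∈ Y
      · rw [Finset.sum_eq_single_of_mem e heY, hvY e heY e heY]
        · simp [hne]
        · intro y hy hne'
          rw [hvY y hy e heY, if_neg hne'.symm, if_neg hne]
          simp
      · rw [hw e heB heY, Finset.sum_eq_zero, sub_zero]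
        intro y hy
        rw [hvoff y hy e heB heY, mul_zero]
    have hon : (w - ∑ y ∈ Y, w y • v y) y₀ = ∑ y ∈ Y, w y * t y := by
      simp only [Pi.sub_apply, Finset.sum_apply, Pi.smul_apply, smul_eq_mul]
      have : ∀ y ∈ Y, w y * v y y₀ = (if y = y₀ then w y else 0) - w y * t y := by
        intro y hy
        rw [hvY y hy y₀ hy₀]
        by_cases h : y = y₀
        · subst h; simp [mul_sub]
        · rw [if_neg h, if_neg (fun h' => h h'.symm)]; simp
      rw [Finset.sum_congr rfl this, Finset.sum_sub_distrib, Finset.sum_ite_eq' Y y₀, if_pos hy₀]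
      ring
    constructor
    · intro hwL
      set u := w - ∑ y ∈ Y, w y • v y with hu
      have huL : u ∈ L := L.sub_mem hwL hS
      have h0 := hxi x₀ hx₀ (u - (u x₀ / c x₀) • c) (L.sub_mem huL (L.smul_mem _ hcL)) ?_ ?_
      · refine ⟨?_, u x₀ / c x₀, fun x hx => ?_⟩
        · rw [← hon]
          simpa [hcX y₀ (hdY y₀ hy₀)] using congrFun h0 y₀
        · have := congrFun h0 x
          simp only [Pi.sub_apply, Pi.smul_apply, smul_eq_mul, Pi.zero_apply, sub_eq_zero] at this
          rw [← this, hu]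
          simp
      · intro e h1 h2
        simp [hoff e h2 h1, hcX e h2]
      · simp [hc x₀ hx₀]
    · rintro ⟨h1, k, hk⟩
      have : w = ∑ y ∈ Y, w y • v y + k • c := by
        rw [← sub_eq_iff_eq_add']
        funext e
        by_cases heX : e ∈ X
        · simpa using hk e heX
        · by_cases hey : e = y₀
          · subst hey
            rw [hon, h1]
            simp [hcX e heX]
          · rw [hoff e heX hey]
            simp [hcX e heX]
      rw [this]
      exact L.add_mem hS (L.smul_mem _ hcL)
  let D : α → F := fun e => if e ∈ X then (c e)⁻¹ else t e
  have hDX : ∀ x ∈ X, D x = (c x)⁻¹ := fun x hx => if_pos hx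
  have hDY : ∀ y ∈ Y, D y = t y := fun y hy => if_neg (hdY y hy)
  have hD : ∀ e, e ∈ X ∨ e ∈ Y → D e ≠ 0 := by
    rintro e (he | he)
    · rw [hDX e he]; exact inv_ne_zero (hc e he)
    · rw [hDY e he]; exact ht e he
  have hconv : ∀ w : α → F, (∀ e, e ∉ X → e ∉ Y → w e = 0) →
      (w ∈ L ↔ ∑ y ∈ Y, D y * w y = 0 ∧ ∃ k, ∀ x ∈ X,
        D x * w x + ∑ y ∈ Y, D y * w y * (-(v y x) / (c x * t y)) = k) := by
    intro w hw
    rw [main w hw]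
    refine and_congr (by
      rw [Finset.sum_congr rfl fun y hy =>
        (by rw [hDY y hy, mul_comm] : w y * t y = D y * w y)])
      (exists_congr fun k => forall₂_congr fun x hx => ?_)
    have : ∑ y ∈ Y, D y * w y * (-(v y x) / (c x * t y)) = -(∑ y ∈ Y, w y * v y x) / c x := by
      rw [neg_div, Finset.sum_div, ← Finset.sum_neg_distrib]
      refine Finset.sum_congr rfl fun y hy => ?_
      rw [hDY y hy]
      have := ht y hy
      have := hc x hx
      field_simp
    rw [this, hDX x hx]
    have := hc x hx
    field_simp
    ring_nf
  refine ⟨fun x y => -(v y x) / (c x * t y), fun I hI => ?_⟩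
  rw [hL I (by rwa [hE])]
  have hIX : ∀ e, e ∉ X → e ∉ Y → e ∉ I := fun e h1 h2 h => (hI h).elim h1 h2
  constructor
  · intro h w k hw hs hk
    have hDw : ∀ e, D e * (w e / D e) = w e := by
      intro e
      by_cases he : e ∈ I
      · exact mul_div_cancel₀ _ (hD e (hI he))
      · rw [hw e he]; simp
    have := h (fun e => w e / D e) ((hconv _ ?_).2 ⟨?_, k, ?_⟩) (fun e he => by simp [hw e he])
    · funext e
      have h1 := congrFun this e
      rw [← hDw e]
      simp only [Pi.zero_apply] at h1 ⊢
      rw [h1, mul_zero]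
    · intro e h1 h2
      simp [hw e (hIX e h1 h2)]
    · simpa only [hDw] using hs
    · simpa only [hDw] using hk
  · intro h w hwL hw
    obtain ⟨h1, k, h2⟩ := (hconv w fun e h1 h2 => hw e (hIX e h1 h2)).1 hwL
    have h3 := h (fun e => D e * w e) k (fun e he => by simp [hw e he]) h1 h2
    funext e
    by_cases he : e ∈ I
    · have h4 := congrFun h3 e
      simpa [hD e (hI he)] using h4
    · exact hw e he

theorem sum_mul_eq_two {Y : Finset α} {y y' : α} (hy : y ∈ Y) (hy' : y' ∈ Y) (hne : y ≠ y')
    {w : α → F} (hw : ∀ z ∈ Y, z ≠ y → z ≠ y' → w z = 0) (g : α → F) :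
    ∑ z ∈ Y, w z * g z = w y * g y + w y' * g y' :=
  Finset.sum_eq_add_of_mem y y' hy hy' hne fun z hz h => by rw [hw z hz h.1 h.2, zero_mul]

theorem MulRep.pair_indep {N : Matroid α} {B Y : Finset α} (hd : Disjoint B Y) {P : α → α → F}
    (hP : ∀ b ∈ B, ∀ y ∈ Y, P b y ≠ 0) (h : MulRep N B Y P) {b b' y y' : α}
    (hb : b ∈ B) (hb' : b' ∈ B) (hy : y ∈ Y) (hy' : y' ∈ Y) (hyy : y ≠ y') :
    N.Indep (insert y (insert y' (B \ {b, b'}))) ↔ P b y * P b' y' ≠ P b y' * P b' y := by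
  have hdY : ∀ y ∈ Y, y ∉ B := fun y hy hyB => Finset.disjoint_left.1 hd hyB hy
  rw [h]
  · constructor
    · intro h heq
      let w : α → F := fun e => if e = y then P b y' else if e = y' then - P b y else
        if e ∈ B then P b y' * P e y - P b y * P e y' else 0
      have hwy : w y = P b y' := by simp [w]
      have hwy' : w y' = - P b y := by simp [w, hyy.symm]
      have hwB : ∀ e ∈ B, w e = P b y' * P e y - P b y * P e y' := by
        intro e he
        have h1 : e ≠ y := fun h => hdY y hy (h ▸ he)
        have h2 : e ≠ y' := fun h => hdY y' hy' (h ▸ he)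
        simp [w, h1, h2, he]
      have := h w ?_ ?_
      · have h1 := congrFun this y
        rw [hwy] at h1
        exact hP b hb y' hy' h1
      · intro e he
        simp only [mem_insert_iff, mem_sdiff, mem_singleton_iff, not_or, not_and, not_not,
          SetLike.mem_coe] at he
        by_cases heB : e ∈ B
        · rw [hwB e heB]
          rcases or_iff_not_imp_left.2 (he.2.2 heB) with rfl | rfl
          · ring
          · linear_combination -heq
        · simp [w, he.1, he.2.1, heB]
      · intro e he
        rw [sum_mul_eq_two hy hy' hyy, hwy, hwy', hwB e he]
        · ring
        · intro z hz h1 h2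
          simp [w, h1, h2, hdY z hz]
    · intro hne w hw hB
      have hY0 : ∀ z ∈ Y, z ≠ y → z ≠ y' → w z = 0 := fun z hz h1 h2 =>
        hw z (by simp [h1, h2, hdY z hz])
      simp only [sum_mul_eq_two hy hy' hyy hY0] at hB
      have hm : ∀ e ∈ B, (e = b ∨ e = b') → w e = 0 := by
        intro e he h1
        apply hw
        have h2 : e ≠ y := fun h => hdY y hy (h ▸ he)
        have h3 : e ≠ y' := fun h => hdY y' hy' (h ▸ he)
        simp [h2, h3, he, h1]
      have e1 := hB b hb
      have e2 := hB b' hb'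
      rw [hm b hb (Or.inl rfl)] at e1
      rw [hm b' hb' (Or.inr rfl)] at e2
      have hne' := sub_ne_zero.2 hne
      have hwy : w y = 0 := by
        refine (mul_eq_zero.1 ?_).resolve_right hne'
        linear_combination P b y' * e2 - P b' y' * e1
      have hwy' : w y' = 0 := by
        refine (mul_eq_zero.1 ?_).resolve_right hne'
        linear_combination -P b y * e2 + P b' y * e1
      funext e
      by_cases heB : e ∈ B
      · rw [hB e heB, hwy, hwy']; simp
      · by_cases h1 : e = y
        · rw [h1, hwy]; rfl
        · by_cases h2 : e = y'
          · rw [h2, hwy']; rfl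
          · exact hw e (by simp [h1, h2, heB])
  · refine insert_subset (Or.inr hy) (insert_subset (Or.inr hy') ?_)
    exact sdiff_subset.trans subset_union_left

theorem AddRep.pair_indep {N : Matroid α} {X Y : Finset α} (hd : Disjoint X Y) {q : α → α → F}
    (h : AddRep N X Y q) {x x' y y' : α}
    (hx : x ∈ X) (hx' : x' ∈ X) (hy : y ∈ Y) (hy' : y' ∈ Y) (hyy : y ≠ y') :
    N.Indep (insert y (insert y' (X \ {x, x'}))) ↔ q x y + q x' y' ≠ q x y' + q x' y := by
  have hdY : ∀ y ∈ Y, y ∉ X := fun y hy hyB => Finset.disjoint_left.1 hd hyB hy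
  rw [h]
  · constructor
    · intro h heq
      let w : α → F := fun e => if e = y then 1 else if e = y' then -1 else
        if e ∈ X then q x y - q x y' - (q e y - q e y') else 0
      have hwy : w y = 1 := by simp [w]
      have hwy' : w y' = -1 := by simp [w, hyy.symm]
      have hwX : ∀ e ∈ X, w e = q x y - q x y' - (q e y - q e y') := by
        intro e he
        have h1 : e ≠ y := fun h => hdY y hy (h ▸ he)
        have h2 : e ≠ y' := fun h => hdY y' hy' (h ▸ he)
        simp [w, h1, h2, he]
      have hw0 : ∀ z ∈ Y, z ≠ y → z ≠ y' → w z = 0 := by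
        intro z hz h1 h2
        simp [w, h1, h2, hdY z hz]
      have := h w (q x y - q x y') ?_ ?_ ?_
      · have h1 := congrFun this y
        rw [hwy] at h1
        exact one_ne_zero h1
      · intro e he
        simp only [mem_insert_iff, mem_sdiff, mem_singleton_iff, not_or, not_and, not_not,
          SetLike.mem_coe] at he
        by_cases heB : e ∈ X
        · rw [hwX e heB]
          rcases or_iff_not_imp_left.2 (he.2.2 heB) with rfl | rfl
          · ring
          · linear_combination heq
        · simp [w, he.1, he.2.1, heB]
      · have := sum_mul_eq_two hy hy' hyy hw0 (fun _ => 1)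
        simp only [mul_one] at this
        rw [this, hwy, hwy']
        ring
      · intro e he
        rw [sum_mul_eq_two hy hy' hyy hw0, hwy, hwy', hwX e he]
        ring
    · intro hne w k hw hs hX
      have hY0 : ∀ z ∈ Y, z ≠ y → z ≠ y' → w z = 0 := fun z hz h1 h2 =>
        hw z (by simp [h1, h2, hdY z hz])
      simp only [sum_mul_eq_two hy hy' hyy hY0] at hX
      have hs' := sum_mul_eq_two hy hy' hyy hY0 (fun _ => 1)
      simp only [mul_one] at hs'
      rw [hs] at hs'
      have hm : ∀ e ∈ X, (e = x ∨ e = x') → w e = 0 := by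
        intro e he h1
        apply hw
        have h2 : e ≠ y := fun h => hdY y hy (h ▸ he)
        have h3 : e ≠ y' := fun h => hdY y' hy' (h ▸ he)
        simp [h2, h3, he, h1]
      have e1 := hX x hx
      have e2 := hX x' hx'
      rw [hm x hx (Or.inl rfl)] at e1
      rw [hm x' hx' (Or.inr rfl)] at e2
      have hne' := sub_ne_zero.2 hne
      have hwy : w y = 0 := by
        refine (mul_eq_zero.1 ?_).resolve_right hne'
        linear_combination e1 - e2 + (q x y' - q x' y') * hs'
      have hwy' : w y' = 0 := by
        linear_combination -hs' - hwy
      have hk : k = 0 := by rw [← e1, hwy, hwy']; ring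
      funext e
      by_cases heB : e ∈ X
      · have := hX e heB
        rw [hwy, hwy', hk] at this
        simpa using this
      · by_cases h1 : e = y
        · rw [h1, hwy]; rfl
        · by_cases h2 : e = y'
          · rw [h2, hwy']; rfl
          · exact hw e (by simp [h1, h2, heB])
  · refine insert_subset (Or.inr hy) (insert_subset (Or.inr hy') ?_)
    exact sdiff_subset.trans subset_union_left

end Relax

namespace Relax

variable {α F : Type*} [Field F]

theorem relation_iff_linearIndepOn (L : Submodule F (α → F)) (s : Finset α) :
    (∀ w ∈ L, (∀ e ∉ s, w e = 0) → w = 0) ↔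
      LinearIndepOn F (fun e => L.mkQ (Pi.single e 1)) (s : Set α) := by
  have hsum : ∀ f : α → F, ∑ i ∈ s, f i • L.mkQ (Pi.single i 1) =
      L.mkQ (fun e => if e ∈ s then f e else 0) := by
    intro f
    rw [show (fun e => if e ∈ s then f e else 0) = ∑ i ∈ s, f i • (Pi.single i 1 : α → F) by
      funext e
      simp [Finset.sum_apply, Pi.single_apply], map_sum]
    simp only [map_smul]
  rw [linearIndepOn_finset_iff]
  constructor
  · intro h f hf i hi
    rw [hsum, Submodule.mkQ_apply, Submodule.Quotient.mk_eq_zero] at hf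
    have := congrFun (h _ hf fun e he => if_neg he) i
    simpa [hi] using this
  · intro h w hw hw0
    have hw1 : (fun e => if e ∈ s then w e else 0) = w := by
      funext e
      by_cases he : e ∈ s
      · simp [he]
      · simp [he, hw0 e he]
    have := h w (by rw [hsum, hw1, Submodule.mkQ_apply, Submodule.Quotient.mk_eq_zero]; exact hw)
    funext e
    by_cases he : e ∈ s
    · exact this e he
    · exact hw0 e he

theorem ncard_eq_finrank_span {V : Type*} [AddCommGroup V] [Module F V] {v : α → V} {I : Set α}
    (hI : I.Finite) (h : LinearIndepOn F v I) :
    I.ncard = Module.finrank F (Submodule.span F (v '' I)) := by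
  have := hI.fintype
  rw [image_eq_range, finrank_span_eq_card (b := fun i : I => v i) h, ← Nat.card_eq_fintype_card,
    Nat.card_coe_set_eq]

theorem exists_linearIndepOn_insert {V : Type*} [AddCommGroup V] [Module F V] {v : α → V}
    {I J : Set α} (hI : I.Finite) (hJ : J.Finite) (h : LinearIndepOn F v I)
    (h' : LinearIndepOn F v J) (hlt : I.ncard < J.ncard) :
    ∃ e ∈ J, e ∉ I ∧ LinearIndepOn F v (insert e I) := by
  by_contra! hcon
  have hle : Submodule.span F (v '' J) ≤ Submodule.span F (v '' I) := by
    rw [Submodule.span_le]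
    rintro _ ⟨e, he, rfl⟩
    by_cases heI : e ∈ I
    · exact Submodule.subset_span (mem_image_of_mem v heI)
    · by_contra hspan
      exact hcon e he heI (h.insert hspan)
  have := FiniteDimensional.span_of_finite F (hI.image v)
  have := Submodule.finrank_mono hle
  rw [← ncard_eq_finrank_span hI h, ← ncard_eq_finrank_span hJ h'] at this
  omega

theorem exists_matroid_isRelationSpace {E : Set α} (hE : E.Finite) (L : Submodule F (α → F)) :
    ∃ N : Matroid α, N.E = E ∧ IsRelationSpace N L := by
  have hcrit : ∀ I ⊆ E, ((∀ w ∈ L, (∀ e ∉ I, w e = 0) → w = 0) ↔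
      LinearIndepOn F (fun e => L.mkQ (Pi.single e 1)) I) := by
    intro I hI
    have := relation_iff_linearIndepOn L (hE.subset hI).toFinset
    simpa using this
  refine ⟨(IndepMatroid.ofFinite hE
    (fun I => I ⊆ E ∧ LinearIndepOn F (fun e => L.mkQ (Pi.single e 1)) I) ?_ ?_ ?_ ?_).matroid,
    rfl, ?_⟩
  · exact ⟨empty_subset _, linearIndepOn_empty _ _⟩
  · exact fun I J hJ hIJ => ⟨hIJ.trans hJ.1, hJ.2.mono hIJ⟩
  · intro I J hI hJ hlt
    obtain ⟨e, he, heI, h⟩ :=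
      exists_linearIndepOn_insert (hE.subset hI.1) (hE.subset hJ.1) hI.2 hJ.2 hlt
    exact ⟨e, he, heI, insert_subset (hJ.1 he) hI.1, h⟩
  · exact fun I hI => hI.1
  · intro I hI
    change I ⊆ E at hI
    rw [hcrit I hI]
    exact ⟨fun h => h.2, fun h => ⟨hI, h⟩⟩

/-- The space of dependencies among the vectors of an additive representation. -/
def addSpace (X Y : Finset α) (q : α → α → F) : Submodule F (α → F) where
  carrier := {w | ∑ y ∈ Y, w y = 0 ∧ ∃ k, ∀ x ∈ X, w x + ∑ y ∈ Y, w y * q x y = k}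
  add_mem' := by
    rintro v w ⟨hv, k, hk⟩ ⟨hw, l, hl⟩
    refine ⟨by simp [Finset.sum_add_distrib, hv, hw], k + l, fun x hx => ?_⟩
    rw [← hk x hx, ← hl x hx]
    simp only [Pi.add_apply, add_mul, Finset.sum_add_distrib]
    ring
  zero_mem' := ⟨by simp, 0, by simp⟩
  smul_mem' := by
    rintro c w ⟨hw, k, hk⟩
    refine ⟨by simp [← Finset.mul_sum, hw], c * k, fun x hx => ?_⟩
    rw [← hk x hx]
    simp only [Pi.smul_apply, smul_eq_mul, mul_add, Finset.mul_sum, mul_assoc]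

theorem addRep_iff {N : Matroid α} {X Y : Finset α} (hE : N.E = (X : Set α) ∪ Y)
    (q : α → α → F) : AddRep N X Y q ↔ IsRelationSpace N (addSpace X Y q) := by
  unfold AddRep IsRelationSpace
  rw [hE]
  refine forall₂_congr fun I _ => ?_
  have : (∀ w ∈ addSpace X Y q, (∀ e ∉ I, w e = 0) → w = 0) ↔
      ∀ (w : α → F) (k : F), (∀ e ∉ I, w e = 0) →
    ∑ y ∈ Y, w y = 0 → (∀ x ∈ X, w x + ∑ y ∈ Y, w y * q x y = k) → w = 0 :=
    ⟨fun h w k h1 h2 h3 => h w ⟨h2, k, h3⟩ h1, fun h w ⟨h2, k, h3⟩ h1 => h w k h1 h2 h3⟩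
  rw [this]

theorem AddRep.hasRelationSpace {N : Matroid α} {X Y : Finset α} (hE : N.E = (X : Set α) ∪ Y)
    {q : α → α → F} (h : AddRep N X Y q) : HasRelationSpace N F :=
  ⟨_, (addRep_iff hE q).1 h⟩

theorem exists_matroid_addRep (X Y : Finset α) (q : α → α → F) :
    ∃ N : Matroid α, N.E = (X : Set α) ∪ Y ∧ AddRep N X Y q := by
  obtain ⟨N, hE, hN⟩ := exists_matroid_isRelationSpace
    (X.finite_toSet.union Y.finite_toSet) (addSpace X Y q)
  exact ⟨N, hE, (addRep_iff hE q).2 hN⟩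

theorem AddRep.not_indep {N : Matroid α} {X Y : Finset α} (hd : Disjoint X Y) (hX : X.Nonempty)
    {q : α → α → F} (h : AddRep N X Y q) : ¬ N.Indep X := by
  have hdY : ∀ y ∈ Y, y ∉ X := fun y hy hyB => Finset.disjoint_left.1 hd hyB hy
  rw [h _ subset_union_left]
  intro h
  obtain ⟨x, hx⟩ := hX
  have := h (fun e => if e ∈ X then 1 else 0) 1 (fun e he => if_neg (by simpa using he))
    (Finset.sum_eq_zero fun y hy => by simp [hdY y hy])
    (fun x hx => by
      rw [Finset.sum_eq_zero fun y hy => by simp [hdY y hy]]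
      simp [hx])
  simpa [hx] using congrFun this x

theorem AddRep.cHyp {N : Matroid α} {X Y : Finset α} (hE : N.E = (X : Set α) ∪ Y)
    (hd : Disjoint X Y) (hX : X.Nonempty)
    {q : α → α → F} (h : AddRep N X Y q) : CHyp N X Y := by
  have hdY : ∀ y ∈ Y, y ∉ X := fun y hy hyB => Finset.disjoint_left.1 hd hyB hy
  refine ⟨h.not_indep hd hX, fun x hx y hy => ?_⟩
  have hsub : (insert y ((X : Set α) \ {x})) ⊆ (X ∪ Y : Set α) :=
    insert_subset (Or.inr hy) (sdiff_subset.trans subset_union_left)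
  have hind : N.Indep (insert y (X \ {x})) := by
    rw [h _ hsub]
    intro w k hw hs hk
    have hz : ∀ z ∈ Y, z ≠ y → w z = 0 := fun z hz hne => hw z (by
      simp [hne, hdY z hz])
    have hwy : w y = 0 := by
      rwa [Finset.sum_eq_single_of_mem y hy fun z h1 h2 => hz z h1 h2] at hs
    have hwY : ∀ z ∈ Y, w z = 0 := fun z h1 => by
      by_cases h2 : z = y
      · rw [h2, hwy]
      · exact hz z h1 h2
    have hk' : ∀ x ∈ X, w x = k := fun x hx => by
      rw [← hk x hx, Finset.sum_eq_zero fun z hz => by rw [hwY z hz, zero_mul], add_zero]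
    have hxw : w x = 0 := hw x (by
      have : x ≠ y := fun h => hdY y hy (h ▸ hx)
      simp [this])
    funext e
    by_cases heX : e ∈ X
    · rw [hk' e heX, ← hk' x hx, hxw]; rfl
    · by_cases heY : e ∈ Y
      · exact hwY e heY
      · refine hw e ?_
        rintro (rfl | h2)
        · exact heY hy
        · exact heX h2.1
  refine hind.isBase_of_forall_insert fun e he hcon => ?_
  rw [hE] at he
  have hsub2 := hcon.subset_ground
  rw [hE] at hsub2
  rw [h _ hsub2] at hcon
  obtain ⟨he, hne⟩ := he
  simp only [mem_insert_iff, Set.mem_sdiff, mem_singleton_iff, not_or, not_and, not_not] at hne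
  by_cases heX : e ∈ X
  · have hex := hne.2 heX
    subst hex
    have := hcon (fun e => if e ∈ X then 1 else 0) 1 (fun z hz => if_neg fun hzX => hz (by
        by_cases hze : z = e
        · exact Or.inl hze
        · exact Or.inr (Or.inr ⟨hzX, hze⟩)))
      (Finset.sum_eq_zero fun y hy => by simp [hdY y hy])
      (fun x hx => by
        rw [Finset.sum_eq_zero fun y hy => by simp [hdY y hy]]
        simp [hx])
    simpa [hx] using congrFun this e
  · have heY : e ∈ Y := by
      rcases he with he | he
      · exact absurd he heX
      · exact he
    let g : α → F := fun z => q z y - q z e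
    let w : α → F := fun z => if z = e then 1 else if z = y then -1 else
      if z ∈ X then g z - g x else 0
    have hwY : ∀ z ∈ Y, z ≠ e → z ≠ y → w z = 0 := fun z hz h1 h2 => by
      simp [w, h1, h2, hdY z hz]
    have hwe : w e = 1 := by simp [w]
    have hwy : w y = -1 := by simp [w, Ne.symm hne.1]
    have := hcon w (- g x) (fun z hz => ?_) ?_ ?_
    · simpa [w] using congrFun this e
    · simp only [mem_insert_iff, Set.mem_sdiff, mem_singleton_iff, not_or, not_and, not_not] at hz
      simp only [w, hz.1, hz.2.1, if_false]
      split_ifs with hzX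
      · rw [hz.2.2 hzX, sub_self]
      · rfl
    · have := sum_mul_eq_two heY hy hne.1 hwY (fun _ => 1)
      simp only [mul_one] at this
      rw [this, hwe, hwy]
      ring
    · intro z hz
      rw [sum_mul_eq_two heY hy hne.1 hwY, hwe, hwy]
      have h1 : z ≠ e := fun h => heX (h ▸ hz)
      have h2 : z ≠ y := fun h => hdY y hy (h ▸ hz)
      simp only [w, h1, h2, hz, if_true, if_false, g]
      ring

end Relax

namespace Relax

variable {α F : Type*} [Field F]

theorem IsUniform.exists_mulRep {N : Matroid α} {r n : ℕ} (hN : IsUniform N r n) (hrn : r ≤ n)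
    (h : HasRelationSpace N F) :
    ∃ (B Y : Finset α) (P : α → α → F), B.card = r ∧ Y.card = n - r ∧
      (∀ b ∈ B, ∀ y ∈ Y, P b y ≠ 0) ∧ ∀ b ∈ B, ∀ b' ∈ B, ∀ y ∈ Y, ∀ y' ∈ Y, b ≠ b' → y ≠ y' →
        P b y * P b' y' ≠ P b y' * P b' y := by
  obtain ⟨hf, hn, hI⟩ := hN
  have hcard : hf.toFinset.card = n := by rw [← ncard_eq_toFinset_card _ hf, hn]
  obtain ⟨B, hB, hBr⟩ := Finset.exists_subset_card_eq (s := hf.toFinset) (n := r) (by omega)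
  have hE : N.E = (B : Set α) ∪ (hf.toFinset \ B : Finset α) := by
    rw [← Finset.coe_union, Finset.union_sdiff_of_subset hB, hf.coe_toFinset]
  have hd : Disjoint B (hf.toFinset \ B) := Finset.disjoint_sdiff
  have hind : ∀ I : Finset α, I ⊆ hf.toFinset → (N.Indep I ↔ I.card ≤ r) := by
    intro I hIE
    rw [hI _ (by simpa [Finset.subset_iff, subset_def] using hIE), ncard_coe_finset]
  have hB1 : FullBase N B (hf.toFinset \ B) := by
    refine ⟨(hind B hB).2 hBr.le, fun y hy => ?_⟩
    rw [Finset.mem_sdiff] at hy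
    constructor
    · rw [← Finset.coe_insert, hind _ (Finset.insert_subset hy.1 hB),
        Finset.card_insert_of_notMem hy.2]
      omega
    · intro b hb
      rw [← Finset.coe_singleton, ← Finset.coe_sdiff, ← Finset.coe_insert,
        hind _ (Finset.insert_subset hy.1 (Finset.sdiff_subset.trans hB))]
      refine (Finset.card_insert_le _ _).trans ?_
      rw [Finset.card_sdiff_of_subset (by simpa using hb), Finset.card_singleton]
      have := Finset.card_pos.2 ⟨b, hb⟩
      omega
  obtain ⟨P, hP, hPN⟩ := Relax.exists_mulRep hE hd h hB1
  refine ⟨B, _, P, hBr, by rw [Finset.card_sdiff_of_subset hB, hcard, hBr], hP, ?_⟩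
  intro b hb b' hb' y hy y' hy' hbb hyy
  rw [← hPN.pair_indep hd hP hb hb' hy hy' hyy]
  rw [Finset.mem_sdiff] at hy hy'
  rw [← Finset.coe_pair, ← Finset.coe_sdiff, ← Finset.coe_insert, ← Finset.coe_insert,
    hind _ (Finset.insert_subset hy.1 (Finset.insert_subset hy'.1
      (Finset.sdiff_subset.trans hB)))]
  have h2 : ({b, b'} : Finset α) ⊆ B := by
    simp [Finset.insert_subset_iff, hb, hb']
  refine (Finset.card_insert_le _ _).trans ?_
  have h3 := Finset.card_insert_le y' (B \ {b, b'})
  have h4 := Finset.card_le_card h2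
  rw [Finset.card_sdiff_of_subset h2] at h3
  rw [Finset.card_pair hbb] at h3 h4
  omega

theorem card_lt_of_minors_ne_zero [Fintype F] {β : Type*} {Y : Finset β} {f g : β → F}
    (hf : ∀ y ∈ Y, f y ≠ 0) (hg : ∀ y ∈ Y, g y ≠ 0)
    (h : ∀ y ∈ Y, ∀ y' ∈ Y, y ≠ y' → f y * g y' ≠ f y' * g y) : Y.card < Fintype.card F := by
  have h1 : Y.card ≤ (Finset.univ.erase (0 : F)).card := by
    refine Finset.card_le_card_of_injOn (fun y => f y / g y) ?_ ?_
    · intro y hy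
      simp [hf y hy, hg y hy]
    · intro y hy y' hy' hyy
      by_contra hne
      apply h y hy y' hy' hne
      exact (div_eq_div_iff (hg y hy) (hg y' hy')).1 hyy
  rw [Finset.card_erase_of_mem (Finset.mem_univ _), Finset.card_univ] at h1
  have := Fintype.card_pos (α := F)
  omega

theorem IsUniform.le_card_add_one [Fintype F] {N : Matroid α} {n : ℕ} (hn : 2 ≤ n)
    (hN : IsUniform N 2 n ∨ IsUniform N (n - 2) n) (h : HasRelationSpace N F) :
    n ≤ Fintype.card F + 1 := by
  rcases hN with hN | hN
  · obtain ⟨B, Y, P, hB, hY, hP, hm⟩ := hN.exists_mulRep hn h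
    obtain ⟨b, b', hbb, rfl⟩ := Finset.card_eq_two.1 hB
    have := card_lt_of_minors_ne_zero (Y := Y) (f := P b) (g := P b')
      (hP b (by simp)) (hP b' (by simp))
      fun y hy y' hy' hne => hm b (by simp) b' (by simp) y hy y' hy' hbb hne
    omega
  · obtain ⟨B, Y, P, hB, hY, hP, hm⟩ := hN.exists_mulRep (by omega) h
    obtain ⟨y, y', hyy, rfl⟩ := Finset.card_eq_two.1 (hY.trans (by omega))
    have := card_lt_of_minors_ne_zero (Y := B) (f := fun b => P b y) (g := fun b => P b y')
      (fun b hb => hP b hb y (by simp)) (fun b hb => hP b hb y' (by simp))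
      fun b hb b' hb' hne => by
        have := hm b hb b' hb' y (by simp) y' (by simp) hne hyy
        rwa [mul_comm (P b' y)] 
    omega

theorem not_hasUnifMinor [Fintype F] {N : Matroid α} {r n : ℕ} (hn : Fintype.card F + 1 < n)
    (hr : r = 2 ∨ r = n - 2) (h : HasRelationSpace N F) : ¬ HasUnifMinor N r n := by
  rintro ⟨N₀, hm, hu⟩
  have := Fintype.card_pos (α := F)
  have := IsUniform.le_card_add_one (F := F) (N := N₀) (n := n) (by omega)
    (by rcases hr with rfl | rfl <;> simp [hu]) (h.minor hm)
  omega

end Relax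

namespace Relax

variable {α F : Type*} [Field F]

theorem FullBase.isBase {N : Matroid α} {B Y : Finset α} (hE : N.E = (B : Set α) ∪ Y)
    (h : FullBase N B Y) : N.IsBase B := by
  refine h.1.isBase_of_forall_insert fun e he => ?_
  rw [hE] at he
  rcases he with ⟨he | he, hne⟩
  · exact absurd he hne
  · exact (h.2 e he).1

theorem FullBase.hasUnifMinor {N : Matroid α} {B Y B₀ Y₀ : Finset α}
    (hE : N.E = (B : Set α) ∪ Y) (hd : Disjoint B Y) (h : FullBase N B Y)
    (hB : B₀ ⊆ B) (hY : Y₀ ⊆ Y) (hc : B₀.card ≤ 2 ∨ Y₀.card ≤ 2)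
    (hp : ∀ b ∈ B₀, ∀ b' ∈ B₀, ∀ y ∈ Y₀, ∀ y' ∈ Y₀, b ≠ b' → y ≠ y' →
      N.Indep (insert y (insert y' (B \ {b, b'})))) :
    HasUnifMinor N B₀.card (B₀.card + Y₀.card) := by
  have hdY : ∀ y ∈ Y, y ∉ B := fun y hy hyB => Finset.disjoint_left.1 hd hyB hy
  have hCE : ((B \ B₀ : Finset α) : Set α) ⊆ N.E := by
    rw [hE]; exact fun e he => Or.inl (Finset.sdiff_subset he)
  have hC : N.Indep (B \ B₀ : Finset α) :=
    h.1.subset (by exact_mod_cast Finset.sdiff_subset)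
  have hground : (N ／ ((B \ B₀ : Finset α) : Set α)).E \ ((Y \ Y₀ : Finset α) : Set α) =
      ((B₀ ∪ Y₀ : Finset α) : Set α) := by
    ext e
    rw [contract_ground, hE]
    simp only [Set.mem_sdiff, mem_union, Finset.mem_coe, Finset.mem_sdiff, Finset.mem_union]
    have h1 := @hB e
    have h2 := @hY e
    have h3 := hdY e
    tauto
  refine ⟨delete (contract N (B \ B₀ : Finset α)) (Y \ Y₀ : Finset α),
    ⟨_, _, hCE, ?_, ?_, rfl⟩, ?_⟩
  · rw [hE]; exact fun e he => Or.inr (Finset.sdiff_subset he)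
  · rw [Finset.disjoint_coe]
    exact hd.mono Finset.sdiff_subset Finset.sdiff_subset
  have hE0 : (delete (contract N (B \ B₀ : Finset α)) (Y \ Y₀ : Finset α)).E =
      ((B₀ ∪ Y₀ : Finset α) : Set α) := hground
  refine ⟨by rw [hE0]; exact Finset.finite_toSet _, ?_, ?_⟩
  · rw [hE0, ncard_coe_finset, Finset.card_union_of_disjoint (hd.mono hB hY)]
  intro I hI
  rw [hE0] at hI
  obtain ⟨I, rfl⟩ : ∃ J : Finset α, (J : Set α) = I :=
    ⟨((Finset.finite_toSet _).subset hI).toFinset, by simp⟩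
  rw [Finset.coe_subset] at hI
  have hdI : Disjoint (I : Set α) (B \ B₀ : Finset α) := by
    rw [Finset.disjoint_coe, Finset.disjoint_left]
    intro e he he'
    rw [Finset.mem_sdiff] at he'
    rcases Finset.mem_union.1 (hI he) with h1 | h1
    · exact he'.2 h1
    · exact hdY e (hY h1) he'.1
  have hind : (delete (contract N (B \ B₀ : Finset α)) (Y \ Y₀ : Finset α)).Indep I ↔
      N.Indep (I ∪ (B \ B₀ : Finset α)) := by
    change ((N ／ ((B \ B₀ : Finset α) : Set α)) ↾ _).Indep I ↔ _
    have hE0' : (contract N (B \ B₀ : Finset α)).E \ ((Y \ Y₀ : Finset α) : Set α) = _ := hground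
    rw [restrict_indep_iff, hE0', hC.contract_indep_iff]
    simp only [Finset.coe_subset, hI, and_true, hdI, true_and]
  rw [hind, ncard_coe_finset]
  constructor
  · intro hi
    have hbase := h.isBase hE
    obtain ⟨B', hB', hsub⟩ := hi.exists_isBase_superset
    have hcard := hB'.ncard_eq_ncard_of_isBase hbase
    have hfin : B'.Finite :=
      (hE ▸ B.finite_toSet.union Y.finite_toSet : N.E.Finite).subset hB'.subset_ground
    have h1 := ncard_le_ncard hsub hfin
    rw [hcard, ncard_coe_finset, ← Finset.coe_union, ncard_coe_finset,
      Finset.card_union_of_disjoint (by exact_mod_cast hdI), Finset.card_sdiff_of_subset hB] at h1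
    have := Finset.card_le_card hB
    omega
  · intro hle
    obtain ⟨J, hIJ, hJ, hJc⟩ := Finset.exists_subsuperset_card_eq hI hle (by
      exact Finset.card_le_card Finset.subset_union_left)
    have hSU : (J \ B₀).card = (B₀ \ J).card := Finset.card_sdiff_comm hJc
    have hUY : J \ B₀ ⊆ Y₀ := by
      intro e he
      rw [Finset.mem_sdiff] at he
      exact (Finset.mem_union.1 (hJ he.1)).resolve_left he.2
    have hSB : B₀ \ J ⊆ B₀ := Finset.sdiff_subset
    have h2 : (J \ B₀).card ≤ 2 := by
      have := Finset.card_le_card hUY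
      have := Finset.card_le_card hSB
      omega
    suffices hgoal : N.Indep ((J \ B₀ : Finset α) ∪ ((B : Set α) \ (B₀ \ J : Finset α))) by
      refine hgoal.subset ?_
      rintro e (he | he)
      · have heJ := hIJ he
        by_cases h0 : e ∈ B₀
        · right
          refine ⟨hB h0, ?_⟩
          simp [heJ]
        · left
          simp [heJ, h0]
      · right
        simp only [Finset.coe_sdiff, Set.mem_sdiff, Finset.mem_coe] at he ⊢
        tauto
    rcases Nat.lt_or_ge (J \ B₀).card 1 with h0 | h0
    · have e1 : J \ B₀ = ∅ := Finset.card_eq_zero.1 (by omega)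
      have e2 : B₀ \ J = ∅ := Finset.card_eq_zero.1 (by omega)
      rw [e1, e2]
      simpa using h.1
    rcases Nat.lt_or_ge (J \ B₀).card 2 with h1 | h1
    · obtain ⟨y, hy⟩ := Finset.card_eq_one.1 (show (J \ B₀).card = 1 by omega)
      obtain ⟨b, hb⟩ := Finset.card_eq_one.1 (show (B₀ \ J).card = 1 by omega)
      rw [hy, hb]
      rw [hy] at hUY
      rw [hb] at hSB
      simp only [Finset.coe_singleton, singleton_union]
      exact (h.2 y (hY (hUY (by simp)))).2 b (hB (hSB (by simp)))
    · obtain ⟨y, y', hyy, hy⟩ := Finset.card_eq_two.1 (show (J \ B₀).card = 2 by omega)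
      obtain ⟨b, b', hbb, hb⟩ := Finset.card_eq_two.1 (show (B₀ \ J).card = 2 by omega)
      rw [hy, hb]
      rw [hy] at hUY
      rw [hb] at hSB
      have := hp b (hSB (by simp)) b' (hSB (by simp)) y (hUY (by simp)) y' (hUY (by simp)) hbb hyy
      simpa [insert_union] using this

end Relax

namespace Relax

variable {α F : Type*} [Field F]

theorem indep_exchange_of_agree {N₁ N₂ : Matroid α} {C : Set α} (hE : N₁.E = N₂.E)
    (h : ∀ I, I ≠ C → (N₁.Indep I ↔ N₂.Indep I)) (h₁ : ¬ N₁.Indep C) (h₂ : N₂.Indep C)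
    {r c : α} (hrC : r ∉ C) (hr : N₁.Indep {r}) (hc : c ∈ C) :
    N₂.Indep (insert r (C \ {c})) := by
  by_contra hn
  have hrE : r ∈ N₁.E := hr.subset_ground rfl
  have hCE : C ⊆ N₁.E := hE ▸ h₂.subset_ground
  have hC : N₁.IsCircuit C := by
    rw [isCircuit_iff_forall_ssubset]
    exact ⟨⟨h₁, hCE⟩, fun I hI => (h I hI.ne).2 (h₂.subset hI.subset)⟩
  have hsubE : insert r (C \ {c}) ⊆ N₂.E := hE ▸ insert_subset hrE (sdiff_subset.trans hCE)
  obtain ⟨K, hKC, hK⟩ := Dep.exists_isCircuit_subset (M := N₂) ⟨hn, hsubE⟩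
  have hcr : c ≠ r := fun h => hrC (h ▸ hc)
  have hcK : c ∉ K := fun h => by simpa [hcr] using hKC h
  have hKne : K ≠ C := fun h => hcK (h ▸ hc)
  have hKdep : ¬ N₁.Indep K := fun h' => hK.not_indep ((h K hKne).1 h')
  obtain ⟨K₁, hK₁K, hK₁⟩ := Dep.exists_isCircuit_subset (M := N₁)
    ⟨hKdep, hE ▸ hK.subset_ground⟩
  obtain ⟨d, hd, hdr⟩ : ∃ d ∈ K₁, d ≠ r := by
    by_contra! hcon
    exact hK₁.not_indep (hr.subset hcon)
  have hdC : d ∈ C := by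
    have := hKC (hK₁K hd)
    simp only [mem_insert_iff, hdr, false_or] at this
    exact this.1
  obtain ⟨K', hK'sub, hK'⟩ := hC.elimination hK₁ (fun h => hcK (hK₁K (h ▸ hc))) d
  have hdK' : d ∉ K' := fun h => (hK'sub h).2 rfl
  have hK'dep : ¬ N₂.Indep K' := fun h' =>
    hK'.not_indep ((h K' fun h => hdK' (h ▸ hdC)).2 h')
  obtain ⟨K₂, hK₂K', hK₂⟩ := Dep.exists_isCircuit_subset (M := N₂)
    ⟨hK'dep, hE ▸ hK'.subset_ground⟩
  have hKins : K ⊆ insert r C := hKC.trans (insert_subset_insert sdiff_subset)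
  have e₁ := hK.eq_fundCircuit_of_subset h₂ hKins
  have e₂ := hK₂.eq_fundCircuit_of_subset h₂ (hK₂K'.trans (hK'sub.trans
    (sdiff_subset.trans (union_subset (subset_insert _ _) (hK₁K.trans hKins)))))
  exact hdK' (hK₂K' (e₂.trans e₁.symm ▸ hK₁K hd))

end Relax

namespace Relax

variable {α F : Type*} [Field F]

theorem exists_hom_zmod (G : Type*) [Group G] [IsCyclic G] {n : ℕ} (h : Nat.card G = n) :
    ∃ f : G → ZMod n, Function.Injective f ∧ ∀ a b, f (a * b) = f a + f b := by
  subst h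
  let e := (zmodCyclicMulEquiv (G := G) inferInstance).symm
  exact ⟨fun g => Multiplicative.toAdd (e g),
    fun a b hab => e.injective (Multiplicative.toAdd.injective hab), fun a b => by simp⟩

/-- A discrete logarithm on the nonzero elements of `GF4`. -/
def IsLog (l : GF4 → ZMod 3) : Prop :=
  (∀ a b, a ≠ 0 → b ≠ 0 → l (a * b) = l a + l b) ∧ ∀ a b, a ≠ 0 → b ≠ 0 → (l a = l b ↔ a = b)

theorem exists_isLog : ∃ l, IsLog l := by
  have : Finite GF4 := inferInstance
  have hcard : Nat.card GF4ˣ = 3 := by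
    rw [Nat.card_units, GaloisField.card 2 2 (by norm_num)]
    rfl
  obtain ⟨f, hf, hmul⟩ := exists_hom_zmod GF4ˣ hcard
  refine ⟨fun a => if h : a = 0 then 0 else f (Units.mk0 a h), ?_, ?_⟩
  · intro a b ha hb
    simp only [ha, hb, mul_eq_zero, or_self, dite_false]
    rw [← hmul]
    congr 1
    ext
    simp
  · intro a b ha hb
    simp only [ha, hb, dite_false, hf.eq_iff, Units.mk0_inj]

theorem IsLog.mul_eq_mul_iff {l : GF4 → ZMod 3} (hl : IsLog l) {a b c d : GF4} (ha : a ≠ 0)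
    (hb : b ≠ 0) (hc : c ≠ 0) (hd : d ≠ 0) : a * b = c * d ↔ l a + l b = l c + l d := by
  rw [← hl.1 a b ha hb, ← hl.1 c d hc hd, hl.2 _ _ (mul_ne_zero ha hb) (mul_ne_zero hc hd)]

theorem zmod_three_linked : ∀ a b a' b' : ZMod 3, (a = 0 ↔ a' = 0) → (b = 0 ↔ b' = 0) →
    (a = b ↔ a' = b') → a * b' = a' * b := by decide

theorem zmod_three_linked_add : ∀ a b a' b' : ZMod 3, (a = 0 ↔ a' = 0) → (b = 0 ↔ b' = 0) →
    (a + b = 0 ↔ a' + b' = 0) → a * b' = a' * b := by decide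

theorem zmod_three_trans : ∀ a b c a' b' c' : ZMod 3, b ≠ 0 → a * b' = a' * b →
    b * c' = b' * c → a * c' = a' * c := by decide

theorem zmod_three_ratio : ∀ a a' : ZMod 3, a ≠ 0 → a' ≠ 0 →
    ∃ ε : ZMod 3, (ε = 1 ∨ ε = -1) ∧ ∀ d d', a * d' = a' * d → d' = ε * d := by decide

theorem exists_sign_of_pattern {R C : Type*} {m m' : R → C → ZMod 3} {r₀ : R} {c₀ : C}
    (h₀ : ∀ c, m r₀ c = 0) (h₀' : ∀ c, m' r₀ c = 0) (h₁ : ∀ r, m r c₀ = 0)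
    (h₁' : ∀ r, m' r c₀ = 0)
    (h : ∀ r s c d, m r c + m s d = m r d + m s c ↔ m' r c + m' s d = m' r d + m' s c) :
    ∃ ε : ZMod 3, (ε = 1 ∨ ε = -1) ∧ ∀ r c, m' r c = ε * m r c := by
  have hz : ∀ r c, m r c = 0 ↔ m' r c = 0 := fun r c => by
    simpa [h₀, h₀', h₁, h₁'] using h r r₀ c c₀
  have hrow : ∀ r c d, m r c = m r d ↔ m' r c = m' r d := fun r c d => by
    simpa [h₀, h₀', h₁, h₁'] using h r r₀ c d
  have hcol : ∀ r s c, m r c = m s c ↔ m' r c = m' s c := fun r s c => by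
    simpa [h₀, h₀', h₁, h₁'] using h r s c c₀
  have hrow' : ∀ r c d, m r c * m' r d = m' r c * m r d := fun r c d =>
    zmod_three_linked _ _ _ _ (hz _ _) (hz _ _) (hrow _ _ _)
  have hcol' : ∀ r s c, m r c * m' s c = m' r c * m s c := fun r s c =>
    zmod_three_linked _ _ _ _ (hz _ _) (hz _ _) (hcol _ _ _)
  by_cases hall : ∀ r c, m r c = 0
  · exact ⟨1, Or.inl rfl, fun r c => by rw [(hz r c).1 (hall r c), hall r c, mul_zero]⟩
  push Not at hall
  obtain ⟨r, c, hrc⟩ := hall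
  obtain ⟨ε, hε, hmul⟩ := zmod_three_ratio _ _ hrc (fun h => hrc ((hz r c).2 h))
  refine ⟨ε, hε, fun s d => hmul _ _ ?_⟩
  by_cases h1 : m r d = 0
  · by_cases h2 : m s c = 0
    · refine zmod_three_linked_add _ _ _ _ (hz _ _) (hz _ _) ?_
      have := h r s c d
      rwa [h1, h2, (hz _ _).1 h1, (hz _ _).1 h2, add_zero] at this
    · exact zmod_three_trans _ _ _ _ _ _ h2 (hcol' _ _ _) (hrow' _ _ _)
  · exact zmod_three_trans _ _ _ _ _ _ h1 (hrow' _ _ _) (hcol' _ _ _)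

theorem MulRep.indep_of_scaled {N N' : Matroid α} {B Y : Finset α} (hd : Disjoint B Y)
    {P P' : α → α → F} (h : MulRep N B Y P) (h' : MulRep N' B Y P') (σ : F →+* F) {A C : α → F}
    (hA : ∀ b ∈ B, A b ≠ 0) (hC : ∀ y ∈ Y, C y ≠ 0)
    (hP : ∀ b ∈ B, ∀ y ∈ Y, P' b y = A b * σ (P b y) * C y) {I : Set α} (hI : I ⊆ (B ∪ Y : Set α))
    (hi : N'.Indep I) : N.Indep I := by
  have hdY : ∀ y ∈ Y, y ∉ B := fun y hy hyB => Finset.disjoint_left.1 hd hyB hy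
  rw [h _ hI]
  rw [h' _ hI] at hi
  intro w hw hrel
  have key := hi (fun e => if e ∈ B then A e * σ (w e) else σ (w e) / C e)
    (fun e he => by simp [hw e he]) (fun b hb => ?_)
  · funext e
    by_cases heI : e ∈ I
    · have := congrFun key e
      by_cases heB : e ∈ B
      · simpa [heB, hA e heB] using this
      · have heY : e ∈ Y := (hI heI).resolve_left heB
        simpa [heB, hC e heY] using this
    · exact hw e heI
  · simp only [hb, if_true]
    rw [hrel b hb, map_sum, Finset.mul_sum]
    refine Finset.sum_congr rfl fun y hy => ?_
    rw [if_neg (hdY y hy), hP b hb y hy, map_mul]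
    have := hC y hy
    field_simp

theorem exists_scaling {B Y : Finset α} (hB : B.Nonempty) (hY : Y.Nonempty)
    {P P' : α → α → GF4} (hP : ∀ b ∈ B, ∀ y ∈ Y, P b y ≠ 0) (hP' : ∀ b ∈ B, ∀ y ∈ Y, P' b y ≠ 0)
    (h : ∀ b ∈ B, ∀ b' ∈ B, ∀ y ∈ Y, ∀ y' ∈ Y,
      (P b y * P b' y' = P b y' * P b' y ↔ P' b y * P' b' y' = P' b y' * P' b' y)) :
    ∃ (σ : GF4 →+* GF4) (A C : α → GF4), (∀ b ∈ B, A b ≠ 0) ∧ (∀ y ∈ Y, C y ≠ 0) ∧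
      ∀ b ∈ B, ∀ y ∈ Y, P' b y = A b * σ (P b y) * C y := by
  obtain ⟨l, hl⟩ := exists_isLog
  obtain ⟨b₀, hb₀⟩ := hB
  obtain ⟨y₀, hy₀⟩ := hY
  obtain ⟨ε, hε, hm⟩ := exists_sign_of_pattern (R := B) (C := Y)
    (m := fun b y => l (P b y) + l (P b₀ y₀) - l (P b y₀) - l (P b₀ y))
    (m' := fun b y => l (P' b y) + l (P' b₀ y₀) - l (P' b y₀) - l (P' b₀ y))
    (r₀ := ⟨b₀, hb₀⟩) (c₀ := ⟨y₀, hy₀⟩) (fun _ => by simp only; ring) (fun _ => by simp only; ring)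
    (fun _ => by simp only; ring) (fun _ => by simp only; ring) (by
      rintro ⟨b, hb⟩ ⟨b', hb'⟩ ⟨y, hy⟩ ⟨y', hy'⟩
      have := h b hb b' hb' y hy y' hy'
      rw [hl.mul_eq_mul_iff (hP _ hb _ hy) (hP _ hb' _ hy') (hP _ hb _ hy') (hP _ hb' _ hy),
        hl.mul_eq_mul_iff (hP' _ hb _ hy) (hP' _ hb' _ hy') (hP' _ hb _ hy') (hP' _ hb' _ hy)]
        at this
      convert this using 1
      · constructor <;> intro h <;> linear_combination h
      · constructor <;> intro h <;> linear_combination h)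
  have hσ : ∃ σ : GF4 →+* GF4, ∀ a, a ≠ 0 → l (σ a) = ε * l a := by
    rcases hε with rfl | rfl
    · exact ⟨RingHom.id _, fun a _ => by simp⟩
    · refine ⟨frobenius GF4 2, fun a ha => ?_⟩
      rw [frobenius_def, pow_two, hl.1 a a ha ha]
      generalize l a = t
      revert t
      decide
  obtain ⟨σ, hσ⟩ := hσ
  have hσ0 : ∀ a, a ≠ 0 → σ a ≠ 0 := fun a ha => by simpa using ha
  refine ⟨σ, fun b => P' b y₀ / σ (P b y₀),
    fun y => P' b₀ y * σ (P b₀ y₀) / (σ (P b₀ y) * P' b₀ y₀), ?_, ?_, ?_⟩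
  · intro b hb
    exact div_ne_zero (hP' _ hb _ hy₀) (hσ0 _ (hP _ hb _ hy₀))
  · intro y hy
    exact div_ne_zero (mul_ne_zero (hP' _ hb₀ _ hy) (hσ0 _ (hP _ hb₀ _ hy₀)))
      (mul_ne_zero (hσ0 _ (hP _ hb₀ _ hy)) (hP' _ hb₀ _ hy₀))
  · intro b hb y hy
    have h1 := hm ⟨b, hb⟩ ⟨y, hy⟩
    simp only at h1
    have p1 := hP _ hb _ hy
    have p2 := hP _ hb _ hy₀
    have p3 := hP _ hb₀ _ hy
    have p4 := hP _ hb₀ _ hy₀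
    have q1 := hP' _ hb _ hy
    have q2 := hP' _ hb _ hy₀
    have q3 := hP' _ hb₀ _ hy
    have q4 := hP' _ hb₀ _ hy₀
    have s1 := hσ0 _ p1
    have s2 := hσ0 _ p2
    have s3 := hσ0 _ p3
    have s4 := hσ0 _ p4
    have h2 : (P' b y * P' b₀ y₀) * (σ (P b y₀) * σ (P b₀ y)) =
        (P' b y₀ * P' b₀ y) * (σ (P b y) * σ (P b₀ y₀)) := by
      rw [hl.mul_eq_mul_iff (mul_ne_zero q1 q4) (mul_ne_zero s2 s3) (mul_ne_zero q2 q3)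
        (mul_ne_zero s1 s4), hl.1 _ _ q1 q4, hl.1 _ _ q2 q3, hl.1 _ _ s2 s3, hl.1 _ _ s1 s4,
        hσ _ p1, hσ _ p2, hσ _ p3, hσ _ p4]
      linear_combination h1
    field_simp
    linear_combination h2

theorem FullBase.indep_of_pairs {N N' : Matroid α} {B Y : Finset α} (hE : N.E = (B : Set α) ∪ Y)
    (hE' : N'.E = (B : Set α) ∪ Y) (hd : Disjoint B Y) (hB : B.Nonempty) (hY : Y.Nonempty)
    (h : HasRelationSpace N GF4) (h' : HasRelationSpace N' GF4) (hN : FullBase N B Y)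
    (hN' : FullBase N' B Y)
    (hp : ∀ b ∈ B, ∀ b' ∈ B, ∀ y ∈ Y, ∀ y' ∈ Y, b ≠ b' → y ≠ y' →
      (N.Indep (insert y (insert y' (B \ {b, b'}))) ↔
        N'.Indep (insert y (insert y' (B \ {b, b'}))))) {I : Set α} (hi : N'.Indep I) :
    N.Indep I := by
  obtain ⟨P, hP, hPN⟩ := exists_mulRep hE hd h hN
  obtain ⟨P', hP', hPN'⟩ := exists_mulRep hE' hd h' hN'
  obtain ⟨σ, A, C, hA, hC, hS⟩ := exists_scaling hB hY hP hP' (by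
    intro b hb b' hb' y hy y' hy'
    by_cases hbb : b = b'
    · subst hbb
      simp only [mul_comm]
    by_cases hyy : y = y'
    · subst hyy
      simp
    · have := hp b hb b' hb' y hy y' hy' hbb hyy
      rw [hPN.pair_indep hd hP hb hb' hy hy' hyy, hPN'.pair_indep hd hP' hb hb' hy hy' hyy] at this
      exact not_iff_not.1 this)
  exact hPN.indep_of_scaled hd hPN' σ hA hC hS (hE' ▸ hi.subset_ground) hi

end Relax

namespace Relax

variable {α F : Type*} [Field F]

/-- Exchanging the elements `x ≠ x'` of `X` for `y ≠ y'` gives an independent set. -/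
def PairIndep (N : Matroid α) (X : Finset α) (x x' y y' : α) : Prop :=
  x ≠ x' ∧ y ≠ y' ∧ N.Indep (insert y (insert y' (X \ {x, x'})))

theorem AddRep.pairIndep_iff {N : Matroid α} {X Y : Finset α} (hd : Disjoint X Y) {q : α → α → F}
    (h : AddRep N X Y q) {x x' y y' : α}
    (hx : x ∈ X) (hx' : x' ∈ X) (hy : y ∈ Y) (hy' : y' ∈ Y) :
    PairIndep N X x x' y y' ↔ q x y + q x' y' ≠ q x y' + q x' y := by
  unfold PairIndep
  by_cases hxx : x = x'
  · subst hxx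
    simp [add_comm]
  by_cases hyy : y = y'
  · simp [hyy]
  rw [h.pair_indep hd hx hx' hy hy' hyy]
  simp [hxx, hyy]

theorem MulRep.pairIndep_iff {N : Matroid α} {B Y : Finset α} (hd : Disjoint B Y) {P : α → α → F}
    (hP : ∀ b ∈ B, ∀ y ∈ Y, P b y ≠ 0) (h : MulRep N B Y P) {b b' y y' : α}
    (hb : b ∈ B) (hb' : b' ∈ B) (hy : y ∈ Y) (hy' : y' ∈ Y) :
    PairIndep N B b b' y y' ↔ P b y * P b' y' ≠ P b y' * P b' y := by
  unfold PairIndep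
  by_cases hbb : b = b'
  · subst hbb
    simp [mul_comm]
  by_cases hyy : y = y'
  · simp [hyy]
  rw [h.pair_indep hd hP hb hb' hy hy' hyy]
  simp [hbb, hyy]

/-- No two elements of `X` with three elements of `Y`, and no three with two, have all their
exchanged pairs independent. -/
def TwoValued (N : Matroid α) (X Y : Finset α) : Prop :=
  (∀ x ∈ X, ∀ x' ∈ X, ∀ y₁ ∈ Y, ∀ y₂ ∈ Y, ∀ y₃ ∈ Y, ¬ (PairIndep N X x x' y₁ y₂ ∧
    PairIndep N X x x' y₁ y₃ ∧ PairIndep N X x x' y₂ y₃)) ∧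
  ∀ x₁ ∈ X, ∀ x₂ ∈ X, ∀ x₃ ∈ X, ∀ y ∈ Y, ∀ y' ∈ Y, ¬ (PairIndep N X x₁ x₂ y y' ∧
    PairIndep N X x₁ x₃ y y' ∧ PairIndep N X x₂ x₃ y y')

theorem TwoValued.exists_eq [CharP F 2] {N : Matroid α} {X Y : Finset α} (hd : Disjoint X Y)
    {q : α → α → F} (h : AddRep N X Y q) (h2 : TwoValued N X Y) {x₀ y₀ : α} (hx₀ : x₀ ∈ X)
    (hy₀ : y₀ ∈ Y) : ∃ s ≠ 0, ∀ x ∈ X, ∀ y ∈ Y, q x y - q x y₀ - q x₀ y + q x₀ y₀ = 0 ∨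
      q x y - q x y₀ - q x₀ y + q x₀ y₀ = s := by
  set m : α → α → F := fun x y => q x y - q x y₀ - q x₀ y + q x₀ y₀ with hm
  have hmx₀ : ∀ y, m x₀ y = 0 := fun y => by simp only [m]; ring
  have hmy₀ : ∀ x, m x y₀ = 0 := fun x => by simp only [m]; ring
  have hpair : ∀ x ∈ X, ∀ x' ∈ X, ∀ y ∈ Y, ∀ y' ∈ Y,
      (PairIndep N X x x' y y' ↔ m x y + m x' y' ≠ m x y' + m x' y) := by
    intro x hx x' hx' y hy y' hy'
    rw [h.pairIndep_iff hd hx hx' hy hy']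
    apply not_congr
    simp only [m]
    constructor <;> intro h <;> linear_combination h
  have hrow : ∀ x ∈ X, ∀ y ∈ Y, ∀ y' ∈ Y, m x y ≠ 0 → m x y' ≠ 0 → m x y = m x y' := by
    intro x hx y hy y' hy' h1 h2'
    by_contra hne
    refine h2.1 x hx x₀ hx₀ y₀ hy₀ y hy y' hy' ⟨?_, ?_, ?_⟩ <;>
      rw [hpair x hx x₀ hx₀ _ (by assumption) _ (by assumption)] <;>
      simp_all [eq_comm]
  have hcol : ∀ y ∈ Y, ∀ x ∈ X, ∀ x' ∈ X, m x y ≠ 0 → m x' y ≠ 0 → m x y = m x' y := by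
    intro y hy x hx x' hx' h1 h2'
    by_contra hne
    refine h2.2 x₀ hx₀ x hx x' hx' y hy y₀ hy₀ ⟨?_, ?_, ?_⟩ <;>
      rw [hpair _ (by assumption) _ (by assumption) y hy y₀ hy₀] <;>
      simp_all [eq_comm]
  by_cases hall : ∀ x ∈ X, ∀ y ∈ Y, m x y = 0
  · exact ⟨1, one_ne_zero, fun x hx y hy => Or.inl (hall x hx y hy)⟩
  push Not at hall
  obtain ⟨x₁, hx₁, y₁, hy₁, hs⟩ := hall
  refine ⟨m x₁ y₁, hs, fun x hx y hy => ?_⟩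
  by_contra! hcon
  obtain ⟨ht, hts⟩ : m x y ≠ 0 ∧ m x y ≠ m x₁ y₁ := hcon
  have h1 : m x₁ y = 0 := by
    by_contra h
    exact hts ((hcol y hy _ hx _ hx₁ ht h).trans (hrow _ hx₁ _ hy _ hy₁ h hs))
  have h3 : m x y₁ = 0 := by
    by_contra h
    exact hts ((hrow _ hx _ hy _ hy₁ ht h).trans (hcol _ hy₁ _ hx _ hx₁ h hs))
  refine h2.1 x₁ hx₁ x hx y₀ hy₀ y₁ hy₁ y hy ⟨?_, ?_, ?_⟩
  · rw [hpair x₁ hx₁ x hx _ hy₀ _ hy₁, hmy₀, h3, hmy₀]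
    simpa using hs.symm
  · rw [hpair x₁ hx₁ x hx _ hy₀ _ hy, hmy₀, h1, hmy₀]
    simpa using ht
  · rw [hpair x₁ hx₁ x hx _ hy₁ _ hy, h1, h3, add_zero]
    intro h
    have h4 : m x y + m x y = 0 := CharTwo.add_self_eq_zero _
    apply hts
    linear_combination h4 - h

theorem TwoValued.addRep_zmod [Algebra (ZMod 2) F] {N : Matroid α} {X Y : Finset α}
    (hd : Disjoint X Y) {q : α → α → F} (h : AddRep N X Y q) (h2 : TwoValued N X Y) {x₀ y₀ : α}
    (hx₀ : x₀ ∈ X) (hy₀ : y₀ ∈ Y) : ∃ p : α → α → ZMod 2, AddRep N X Y p := by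
  have hdY : ∀ y ∈ Y, y ∉ X := fun y hy hyB => Finset.disjoint_left.1 hd hyB hy
  have : CharP F 2 := charP_of_injective_algebraMap (algebraMap (ZMod 2) F).injective 2
  obtain ⟨s, hs, hsq⟩ := h2.exists_eq hd h hx₀ hy₀
  let p : α → α → ZMod 2 := fun x y => if q x y - q x y₀ - q x₀ y + q x₀ y₀ = 0 then 0 else 1
  have hq : ∀ x ∈ X, ∀ y ∈ Y, q x y =
      s * algebraMap (ZMod 2) F (p x y) + (q x y₀ - q x₀ y₀) + q x₀ y := by
    intro x hx y hy
    have h0 := hsq x hx y hy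
    by_cases h1 : q x y - q x y₀ - q x₀ y + q x₀ y₀ = 0
    · simp only [p, h1, if_true, map_zero]
      linear_combination h1
    · simp only [p, h1, if_false, map_one]
      linear_combination h0.resolve_left h1
  have hsum : ∀ w : α → F, ∑ y ∈ Y, w y = 0 → ∀ x ∈ X, ∑ y ∈ Y, w y * q x y =
      s * ∑ y ∈ Y, w y * algebraMap (ZMod 2) F (p x y) + ∑ y ∈ Y, w y * q x₀ y := by
    intro w hw x hx
    have : ∑ y ∈ Y, w y * (q x y₀ - q x₀ y₀) = 0 := by rw [← Finset.sum_mul, hw, zero_mul]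
    rw [← add_zero (s * _), ← this, Finset.mul_sum, ← Finset.sum_add_distrib,
      ← Finset.sum_add_distrib]
    refine Finset.sum_congr rfl fun y hy => ?_
    rw [hq x hx y hy]
    ring
  refine ⟨p, fun I hI => ?_⟩
  rw [h I hI]
  constructor
  · intro hi v k hv hv0 hk
    have key := hi (fun e => if e ∈ X then s * algebraMap (ZMod 2) F (v e) else
      algebraMap (ZMod 2) F (v e))
      (s * algebraMap (ZMod 2) F k + ∑ y ∈ Y, algebraMap (ZMod 2) F (v y) * q x₀ y)
      (fun e he => by simp [hv e he]) ?_ ?_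
    · funext e
      have := congrFun key e
      by_cases heX : e ∈ X
      · simpa [heX, hs] using this
      · simpa [heX] using this
    · rw [← map_zero (algebraMap (ZMod 2) F), ← hv0, map_sum]
      exact Finset.sum_congr rfl fun y hy => if_neg (hdY y hy)
    · intro x hx
      have h1 : ∑ y ∈ Y, (if y ∈ X then s * algebraMap (ZMod 2) F (v y) else
          algebraMap (ZMod 2) F (v y)) * q x y =
          ∑ y ∈ Y, algebraMap (ZMod 2) F (v y) * q x y :=
        Finset.sum_congr rfl fun y hy => by rw [if_neg (hdY y hy)]
      rw [h1, hsum _ (by rw [← map_sum, hv0, map_zero]) x hx, if_pos hx, ← hk x hx]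
      simp only [map_add, map_sum, map_mul]
      ring
  · intro hi w k hw hw0 hk
    funext e
    refine (Module.forall_dual_apply_eq_zero_iff (ZMod 2) (w e)).1 fun φ => ?_
    by_cases heI : e ∉ I
    · rw [hw e heI, map_zero]
    push Not at heI
    have key : ∀ φ : Module.Dual (ZMod 2) F,
        (fun e => if e ∈ X then φ (s⁻¹ * w e) else φ (w e)) = 0 := by
      intro φ
      refine hi _ (φ (s⁻¹ * (k - ∑ y ∈ Y, w y * q x₀ y))) (fun e he => by simp [hw e he]) ?_ ?_
      · rw [← map_zero φ, ← hw0, map_sum]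
        exact Finset.sum_congr rfl fun y hy => if_neg (hdY y hy)
      · intro x hx
        have h1 : ∑ y ∈ Y, (if y ∈ X then φ (s⁻¹ * w y) else φ (w y)) * p x y =
            φ (∑ y ∈ Y, w y * algebraMap (ZMod 2) F (p x y)) := by
          rw [map_sum]
          refine Finset.sum_congr rfl fun y hy => ?_
          rw [if_neg (hdY y hy), mul_comm (w y), ← Algebra.smul_def, map_smul, smul_eq_mul,
            mul_comm]
        rw [h1, if_pos hx, ← map_add, ← hk x hx, hsum w hw0 x hx]
        congr 1
        field_simp
        ring
    by_cases heX : e ∈ X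
    · have := congrFun (key (φ.comp (LinearMap.mulLeft (ZMod 2) s))) e
      simpa [heX, hs] using this
    · simpa [heX] using congrFun (key φ) e

end Relax

namespace Relax

variable {α F : Type*} [Field F]

theorem zmod_two_ite_mul : ∀ a b : ZMod 2, (if b = 1 then a else 0) = a * b := by decide

theorem zmod_two_eq_of_iff : ∀ a b : ZMod 2, (a = 1 ↔ b = 1) → a = b := by decide

theorem exists_unseparated {X Y : Finset α} {q : α → α → ZMod 2} {p : α → α → ZMod 3}
    {x₀ y₀ : α} (hx₀ : x₀ ∈ X) (hy₀ : y₀ ∈ Y)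
    (h : ∀ x ∈ X, ∀ x' ∈ X, ∀ y ∈ Y, ∀ y' ∈ Y,
      (q x y + q x' y' = q x y' + q x' y ↔ p x y + p x' y' = p x y' + p x' y))
    {w : α → ZMod 2} {k : ZMod 2} {y₁ : α} (hy₁ : y₁ ∈ Y) (hwy₁ : w y₁ ≠ 0) (hw : ∑ y ∈ Y, w y = 0)
    (hk : ∀ x ∈ X, ∑ y ∈ Y, w y * q x y = k) :
    ∃ y ∈ Y, ∃ y' ∈ Y, y ≠ y' ∧ ∀ x ∈ X, p x y + p x₀ y' = p x y' + p x₀ y := by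
  let n : α → α → ZMod 2 := fun x y => q x y - q x₀ y - q x y₀ + q x₀ y₀
  let m : α → α → ZMod 3 := fun x y => p x y - p x₀ y - p x y₀ + p x₀ y₀
  let S : α → Finset α := fun x => Y.filter fun y => n x y = 1
  have hnm : ∀ x ∈ X, ∀ x' ∈ X, ∀ y ∈ Y, ∀ y' ∈ Y,
      (n x y + n x' y' = n x y' + n x' y ↔ m x y + m x' y' = m x y' + m x' y) := by
    intro x hx x' hx' y hy y' hy'
    have := h x hx x' hx' y hy y' hy'
    convert this using 1
    · constructor <;> intro h <;> simp only [n] at * <;> linear_combination h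
    · constructor <;> intro h <;> simp only [m] at * <;> linear_combination h
  have hn0 : ∀ y, n x₀ y = 0 := fun y => by simp only [n]; ring
  have hn0' : ∀ x, n x y₀ = 0 := fun y => by simp only [n]; ring
  have hm0 : ∀ y, m x₀ y = 0 := fun y => by simp only [m]; ring
  have hm0' : ∀ x, m x y₀ = 0 := fun y => by simp only [m]; ring
  have hz : ∀ x ∈ X, ∀ y ∈ Y, n x y = 0 ↔ m x y = 0 := fun x hx y hy => by
    simpa [hn0, hn0', hm0, hm0'] using hnm x hx x₀ hx₀ y hy y₀ hy₀
  have hrow : ∀ x ∈ X, ∀ y ∈ Y, ∀ y' ∈ Y, n x y = n x y' ↔ m x y = m x y' := by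
    intro x hx y hy y' hy'
    simpa [hn0, hn0', hm0, hm0'] using hnm x hx x₀ hx₀ y hy y' hy'
  have hcol : ∀ x ∈ X, ∀ x' ∈ X, ∀ y ∈ Y, n x y = n x' y ↔ m x y = m x' y := by
    intro x hx x' hx' y hy
    simpa [hn0, hn0', hm0, hm0'] using hnm x hx x' hx' y hy y₀ hy₀
  have hne : ∀ a : ZMod 2, a ≠ 1 → a = 0 := by decide
  have hlam : ∀ x ∈ X, ∀ z ∈ X, ∀ y ∈ S x, y ∈ S z → ∀ y' ∈ S z, y' ∉ S x → S x ⊆ S z := by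
    intro x hx z hz' y hyx hyz y' hyz' hyx' u hux
    by_contra huz
    simp only [S, Finset.mem_filter, not_and] at *
    obtain ⟨hyY, hxy⟩ := hyx
    obtain ⟨hyY', hzy'⟩ := hyz'
    obtain ⟨huY, hxu⟩ := hux
    have hzy := hyz.2
    have hxy' := hne _ (hyx' hyY')
    have hzu := hne _ (huz huY)
    have e1 := (hrow x hx u huY y hyY).1 (hxu.trans hxy.symm)
    have e2 := (hrow z hz' y' hyY' y hyY).1 (hzy'.trans hzy.symm)
    have e3 := (hcol x hx z hz' y hyY).1 (hxy.trans hzy.symm)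
    have e4 := (hz x hx y' hyY').1 hxy'
    have e5 := (hz z hz' u huY).1 hzu
    have e6 := (hnm x hx z hz' u huY y' hyY').1 (by rw [hxu, hzy', hxy', hzu]; decide)
    rw [e1, e2, e4, e5, e3] at e6
    have e7 : m z y ≠ 0 := fun h => by
      have := (hz z hz' y hyY).2 h
      rw [hzy] at this
      exact one_ne_zero this
    revert e7 e6
    generalize m z y = t
    revert t
    decide
  have hSsum : ∀ x ∈ X, ∑ y ∈ S x, w y = 0 := by
    intro x hx
    rw [Finset.sum_filter]
    have : ∀ y ∈ Y, (if n x y = 1 then w y else 0) =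
        w y * q x y - w y * q x₀ y - w y * (q x y₀ - q x₀ y₀) := by
      intro y hy
      rw [zmod_two_ite_mul]
      simp only [n]
      ring
    rw [Finset.sum_congr rfl this, Finset.sum_sub_distrib, Finset.sum_sub_distrib, hk x hx,
      hk x₀ hx₀, ← Finset.sum_mul, hw]
    ring
  obtain ⟨A, hA, hmin⟩ := Finset.exists_min_image
    ((insert Y (X.image S)).filter fun A => ∃ y ∈ A, w y ≠ 0) Finset.card
    ⟨Y, by simp only [Finset.mem_filter, Finset.mem_insert_self, true_and]; exact ⟨y₁, hy₁, hwy₁⟩⟩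
  rw [Finset.mem_filter] at hA
  obtain ⟨hA, y, hyA, hwy⟩ := hA
  have hAY : A ⊆ Y := by
    rcases Finset.mem_insert.1 hA with rfl | hA
    · exact subset_rfl
    · obtain ⟨x, -, rfl⟩ := Finset.mem_image.1 hA
      exact Finset.filter_subset _ _
  have hAsum : ∑ y ∈ A, w y = 0 := by
    rcases Finset.mem_insert.1 hA with rfl | hA
    · exact hw
    · obtain ⟨x, hx, rfl⟩ := Finset.mem_image.1 hA
      exact hSsum x hx
  obtain ⟨y', hyA', hyy, hwy'⟩ : ∃ y' ∈ A, y' ≠ y ∧ w y' ≠ 0 := by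
    by_contra! hcon
    rw [Finset.sum_eq_single_of_mem y hyA hcon] at hAsum
    exact hwy hAsum
  have hsub : ∀ x ∈ X, ∀ u ∈ A, ∀ v ∈ A, w u ≠ 0 → u ∈ S x → v ∈ S x := by
    intro x hx u hu v hv hwu hux
    by_contra hvx
    have hss : S x ⊂ A := by
      refine Finset.ssubset_iff_subset_ne.2 ⟨?_, fun h => hvx (h ▸ hv)⟩
      rcases Finset.mem_insert.1 hA with rfl | hA
      · exact Finset.filter_subset _ _
      · obtain ⟨z, hz, rfl⟩ := Finset.mem_image.1 hA
        exact hlam x hx z hz u hux hu v hv hvx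
    have := hmin (S x) (by
      rw [Finset.mem_filter]
      exact ⟨Finset.mem_insert_of_mem (Finset.mem_image_of_mem S hx), u, hux, hwu⟩)
    exact absurd (Finset.card_lt_card hss) (not_lt.2 this)
  refine ⟨y, hAY hyA, y', hAY hyA', hyy.symm, fun x hx => ?_⟩
  have h1 : n x y = n x y' := by
    apply zmod_two_eq_of_iff
    have a1 := hsub x hx y hyA y' hyA' hwy
    have a2 := hsub x hx y' hyA' y hyA hwy'
    simp only [S, Finset.mem_filter, hAY hyA, hAY hyA', true_and] at a1 a2
    exact ⟨a1, a2⟩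
  have h2 := (hrow x hx y (hAY hyA) y' (hAY hyA')).1 h1
  simp only [m] at h2
  linear_combination h2

theorem indep_of_agree_binary_ternary {M T : Matroid α} {X Y : Finset α}
    (hd : Disjoint X Y) (hX : X.Nonempty) {q : α → α → ZMod 2}
    {p : α → α → ZMod 3} (hq : AddRep M X Y q) (hp : AddRep T X Y p)
    (hpair : ∀ x ∈ X, ∀ x' ∈ X, ∀ y ∈ Y, ∀ y' ∈ Y,
      (PairIndep M X x x' y y' ↔ PairIndep T X x x' y y'))
    (hT : T.Indep Y) : M.Indep Y := by
  have hdX : ∀ x ∈ X, x ∉ Y := fun y hy hyB => Finset.disjoint_left.1 hd hy hyB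
  by_contra hM
  rw [hq _ subset_union_right] at hM
  push Not at hM
  obtain ⟨w, k, hwY, hw, hk, hw0⟩ := hM
  obtain ⟨y₁, hy₁⟩ := Function.ne_iff.1 hw0
  have hy₁Y : y₁ ∈ Y := by
    by_contra h
    exact hy₁ (hwY y₁ h)
  obtain ⟨x₀, hx₀⟩ := hX
  obtain ⟨y, hy, y', hy', hyy, hs⟩ := exists_unseparated (p := p) (k := k) hx₀ hy₁Y (by
    intro x hx x' hx' y hy y' hy'
    have := hpair x hx x' hx' y hy y' hy'
    rw [hq.pairIndep_iff hd hx hx' hy hy', hp.pairIndep_iff hd hx hx' hy hy'] at this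
    exact not_iff_not.1 this) hy₁Y hy₁ hw (fun x hx => by
      rw [← hk x hx, hwY x (hdX x hx), zero_add])
  rw [hp _ subset_union_right] at hT
  have hwz : ∀ z ∈ Y, z ≠ y → z ≠ y' →
      (fun z => if z = y then (1 : ZMod 3) else if z = y' then -1 else 0) z = 0 := by
    intro z _ h1 h2
    simp [h1, h2]
  have := hT (fun z => if z = y then 1 else if z = y' then -1 else 0) (p x₀ y - p x₀ y')
    (fun e he => ?_) ?_ ?_
  · simpa using congrFun this y
  · have h1 : e ≠ y := fun h => he (h ▸ hy)
    have h2 : e ≠ y' := fun h => he (h ▸ hy')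
    simp [h1, h2]
  · have := sum_mul_eq_two hy hy' hyy hwz (fun _ => 1)
    simp only [mul_one, hyy.symm, if_true, if_false] at this
    rw [this]
    ring
  · intro x hx
    rw [sum_mul_eq_two hy hy' hyy hwz]
    have h1 : x ≠ y := fun h => hdX x hx (h ▸ hy)
    have h2 : x ≠ y' := fun h => hdX x hx (h ▸ hy')
    simp only [h1, h2, hyy.symm, if_true, if_false]
    linear_combination hs x hx

end Relax

namespace Relax

variable {α F : Type*} [Field F]

/-- The matroids `M` and `M'` over `GF4` agree except at `X`, and the ternary matroid `T` agrees
with `M` on the sets obtained from `X` by exchanging at most two elements. -/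
structure Linked (M M' T : Matroid α) (X Y : Finset α) : Prop where
  disj : Disjoint X Y
  ground : M.E = (X : Set α) ∪ Y
  ground' : M'.E = (X : Set α) ∪ Y
  groundT : T.E = (X : Set α) ∪ Y
  rep : HasRelationSpace M GF4
  rep' : HasRelationSpace M' GF4
  repT : HasRelationSpace T (ZMod 3)
  cHyp : CHyp M X Y
  cHypT : CHyp T X Y
  indep : M'.Indep X
  agree : ∀ I : Set α, I ≠ X → (M.Indep I ↔ M'.Indep I)
  pair : ∀ x ∈ X, ∀ x' ∈ X, ∀ y ∈ Y, ∀ y' ∈ Y,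
    (PairIndep M X x x' y y' ↔ PairIndep T X x x' y y')

theorem CHyp.indep_singleton {N : Matroid α} {X Y : Finset α} (h : CHyp N X Y) {x x' y : α}
    (hx : x ∈ X) (hx' : x' ∈ X) (hne : x ≠ x') (hy : y ∈ Y) : N.Indep {x} :=
  (h.2 x' hx' y hy).indep.subset (by
    rw [singleton_subset_iff]
    exact Or.inr ⟨hx, hne⟩)

theorem CHyp.indep_iff_of_subset {N : Matroid α} {X Y : Finset α} (h : CHyp N X Y)
    (hY : Y.Nonempty) {I : Set α} (hI : I ⊆ X) : N.Indep I ↔ I ≠ X := by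
  refine ⟨fun hi hIX => h.1 (hIX ▸ hi), fun hne => ?_⟩
  obtain ⟨x, hx, hxI⟩ := exists_of_ssubset (hI.ssubset_of_ne hne)
  obtain ⟨y, hy⟩ := hY
  refine (h.2 x hx y hy).indep.subset fun e he => Or.inr ⟨hI he, ?_⟩
  rintro rfl
  exact hxI he

theorem Linked.indep_compl_of_ternary {M M' T : Matroid α} {X Y : Finset α}
    (h : Linked M M' T X Y) (hX : 1 < X.card) (hY : Y.Nonempty)
    (hag : ∀ I : Set α, I ≠ Y → (M.Indep I ↔ T.Indep I)) (hT : T.Indep Y) : M.Indep Y := by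
  by_contra hM
  have hd := h.disj
  have hdX : ∀ x ∈ X, x ∉ Y := fun y hy hyB => Finset.disjoint_left.1 hd hy hyB
  have hXn : X.Nonempty := Finset.card_pos.1 (by omega)
  obtain ⟨y₀, hy₀⟩ := hY
  have hins : ∀ x ∈ X, ∀ S : Set α, insert x S ≠ (Y : Set α) := fun x hx S hS =>
    hdX x hx (by
      have : x ∈ (Y : Set α) := hS ▸ mem_insert x S
      exact this)
  have hsing : ∀ x ∈ X, M.Indep {x} := by
    intro x hx
    obtain ⟨x', hx', hne⟩ := Finset.exists_mem_ne hX x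
    exact h.cHyp.indep_singleton hx hx' hne.symm hy₀
  have hex : ∀ x ∈ X, ∀ y ∈ Y, T.Indep (insert x (Y \ {y})) := fun x hx y hy =>
    indep_exchange_of_agree (h.ground.trans h.groundT.symm) hag hM hT (hdX x hx) (hsing x hx) hy
  have hTF : FullBase T Y X := by
    refine ⟨hT, fun x hx => ⟨fun hi => ?_, hex x hx⟩⟩
    exact hM (((hag _ (hins x hx _)).2 hi).subset (subset_insert _ _))
  have hgT : T.E = (Y : Set α) ∪ X := h.groundT.trans (union_comm _ _)
  have hgM : M.E = (Y : Set α) ∪ X := h.ground.trans (union_comm _ _)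
  have hTY := hTF.isBase hgT
  have hMC : CHyp M Y X := by
    refine ⟨hM, fun y hy x hx => ?_⟩
    have hb : T.IsBase (insert x (Y \ {y})) := by
      have hxy : x ≠ y := fun h => hdX x hx (h ▸ hy)
      have := hex x hx y hy
      rw [insert_sdiff_singleton_comm hxy] at this ⊢
      exact hTY.exchange_isBase_of_indep' hy (hdX x hx) this
    refine ((hag _ (hins x hx _)).2 hb.indep).isBase_of_forall_insert fun e he hcon => ?_
    rw [insert_comm, hag _ (hins x hx _), insert_comm] at hcon
    exact he.2 (hb.mem_of_insert_indep hcon)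
  have hpair : ∀ y ∈ Y, ∀ y' ∈ Y, ∀ x ∈ X, ∀ x' ∈ X,
      (PairIndep M Y y y' x x' ↔ PairIndep T Y y y' x x') := by
    intro y hy y' hy' x hx x' hx'
    unfold PairIndep
    rw [hag _ (hins x hx _)]
  obtain ⟨q, hq⟩ := exists_addRep hgM hd.symm ⟨y₀, hy₀⟩ hXn h.rep hMC
  obtain ⟨P, hP, hPT⟩ := exists_mulRep hgT hd.symm h.repT hTF
  have h2 : TwoValued M Y X := by
    constructor
    · intro y hy y' hy' x₁ hx₁ x₂ hx₂ x₃ hx₃ hcon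
      simp only [hpair _ hy _ hy' _ hx₁ _ hx₂, hpair _ hy _ hy' _ hx₁ _ hx₃,
        hpair _ hy _ hy' _ hx₂ _ hx₃, hPT.pairIndep_iff hd.symm hP hy hy' hx₁ hx₂,
        hPT.pairIndep_iff hd.symm hP hy hy' hx₁ hx₃,
        hPT.pairIndep_iff hd.symm hP hy hy' hx₂ hx₃] at hcon
      have a1 := hP _ hy _ hx₁
      have a2 := hP _ hy _ hx₂
      have a3 := hP _ hy _ hx₃
      have b1 := hP _ hy' _ hx₁
      have b2 := hP _ hy' _ hx₂
      have b3 := hP _ hy' _ hx₃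
      revert hcon a1 a2 a3 b1 b2 b3
      generalize P y x₁ = a1
      generalize P y x₂ = a2
      generalize P y x₃ = a3
      generalize P y' x₁ = b1
      generalize P y' x₂ = b2
      generalize P y' x₃ = b3
      intro ⟨h1, h2, h3⟩ _ _ _ _ _ _
      have := card_lt_of_minors_ne_zero (Y := (Finset.univ : Finset (Fin 3)))
        (f := ![a1, a2, a3]) (g := ![b1, b2, b3])
        (by simp [Fin.forall_fin_succ, *]) (by simp [Fin.forall_fin_succ, *])
        (by simp [Fin.forall_fin_succ, h1, h2, h3, h1.symm, h2.symm, h3.symm])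
      simp at this
    · intro y₁ hy₁ y₂ hy₂ y₃ hy₃ x hx x' hx' hcon
      simp only [hpair _ hy₁ _ hy₂ _ hx _ hx', hpair _ hy₁ _ hy₃ _ hx _ hx',
        hpair _ hy₂ _ hy₃ _ hx _ hx', hPT.pairIndep_iff hd.symm hP hy₁ hy₂ hx hx',
        hPT.pairIndep_iff hd.symm hP hy₁ hy₃ hx hx',
        hPT.pairIndep_iff hd.symm hP hy₂ hy₃ hx hx'] at hcon
      have a1 := hP _ hy₁ _ hx
      have a2 := hP _ hy₂ _ hx
      have a3 := hP _ hy₃ _ hx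
      have b1 := hP _ hy₁ _ hx'
      have b2 := hP _ hy₂ _ hx'
      have b3 := hP _ hy₃ _ hx'
      revert hcon a1 a2 a3 b1 b2 b3
      generalize P y₁ x = a1
      generalize P y₂ x = a2
      generalize P y₃ x = a3
      generalize P y₁ x' = b1
      generalize P y₂ x' = b2
      generalize P y₃ x' = b3
      intro ⟨h1, h2, h3⟩ _ _ _ _ _ _
      rw [mul_comm b1] at h1 h2
      rw [mul_comm b2] at h3
      have := card_lt_of_minors_ne_zero (Y := (Finset.univ : Finset (Fin 3)))
        (f := ![a1, a2, a3]) (g := ![b1, b2, b3])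
        (by simp [Fin.forall_fin_succ, *]) (by simp [Fin.forall_fin_succ, *])
        (by simp [Fin.forall_fin_succ, h1, h2, h3, h1.symm, h2.symm, h3.symm])
      simp at this
  obtain ⟨x₀, hx₀⟩ := hXn
  obtain ⟨q₂, hq₂⟩ := h2.addRep_zmod hd.symm hq hy₀ hx₀
  obtain ⟨q₁, hq₁⟩ :=
    exists_addRep h.ground hd ⟨x₀, hx₀⟩ ⟨y₀, hy₀⟩ (hq₂.hasRelationSpace hgM) h.cHyp
  obtain ⟨p, hp⟩ := exists_addRep h.groundT hd ⟨x₀, hx₀⟩ ⟨y₀, hy₀⟩ h.repT h.cHypT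
  exact hM (indep_of_agree_binary_ternary hd ⟨x₀, hx₀⟩ hq₁ hp h.pair hT)

theorem Linked.ternary_indep_compl {M M' T : Matroid α} {X Y : Finset α}
    (h : Linked M M' T X Y) (hX : 1 < X.card) (hY : Y.Nonempty) (h3 : ¬ (X.card = 2 ∧ Y.card = 2))
    (hag : ∀ I : Set α, I ≠ Y → (M.Indep I ↔ T.Indep I)) (hM : M.Indep Y) : T.Indep Y := by
  by_contra hT
  have hd := h.disj
  have hdX : ∀ x ∈ X, x ∉ Y := fun y hy hyB => Finset.disjoint_left.1 hd hy hyB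
  have hXn : X.Nonempty := Finset.card_pos.1 (by omega)
  obtain ⟨y₀, hy₀⟩ := hY
  have hins : ∀ x ∈ X, ∀ S : Set α, insert x S ≠ (Y : Set α) := fun x hx S hS =>
    hdX x hx (by
      have : x ∈ (Y : Set α) := hS ▸ mem_insert x S
      exact this)
  have hneX : ∀ y ∈ Y, ∀ S : Set α, y ∈ S → S ≠ (X : Set α) := fun y hy S hyS hS =>
    hdX y (by rw [hS] at hyS; exact hyS) hy
  have hsing : ∀ x ∈ X, T.Indep {x} := by
    intro x hx
    obtain ⟨x', hx', hne⟩ := Finset.exists_mem_ne hX x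
    exact h.cHypT.indep_singleton hx hx' hne.symm hy₀
  have hMF : FullBase M Y X := by
    refine ⟨hM, fun x hx => ⟨fun hi => ?_, fun y hy => ?_⟩⟩
    · exact hT (((hag _ (hins x hx _)).1 hi).subset (subset_insert _ _))
    · exact indep_exchange_of_agree (h.groundT.trans h.ground.symm) (fun I hI => (hag I hI).symm)
        hT hM (hdX x hx) (hsing x hx) hy
  have hMM' : ∀ I : Set α, M.Indep I → M'.Indep I := fun I hI =>
    (h.agree I fun hIX => h.cHyp.1 (hIX ▸ hI)).1 hI
  have hMF' : FullBase M' Y X := by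
    refine ⟨hMM' _ hMF.1, fun x hx => ⟨fun hi => ?_, fun y hy => hMM' _ ((hMF.2 x hx).2 y hy)⟩⟩
    exact (hMF.2 x hx).1 ((h.agree _ (hneX y₀ hy₀ _ (Or.inr hy₀))).2 hi)
  refine h.cHyp.1 (hMF.indep_of_pairs (h.ground.trans (union_comm _ _))
    (h.ground'.trans (union_comm _ _)) hd.symm ⟨y₀, hy₀⟩ hXn h.rep h.rep' hMF' ?_ h.indep)
  intro y hy y' hy' x hx x' hx' hyy hxx
  refine h.agree _ fun heq => h3 ?_
  have hY2 : Y ⊆ {y, y'} := by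
    intro z hz
    by_contra hne
    refine hneX z hz _ (Or.inr (Or.inr ⟨hz, ?_⟩)) heq
    simpa using hne
  have hX2 : X ⊆ {x, x'} := by
    intro z hz
    have : z ∈ (X : Set α) := hz
    rw [← heq] at this
    rcases this with rfl | rfl | hz'
    · simp
    · simp
    · exact absurd hz'.1 (hdX z hz)
  rw [Finset.Subset.antisymm hY2 (by simp [Finset.insert_subset_iff, hy, hy']),
    Finset.Subset.antisymm hX2 (by simp [Finset.insert_subset_iff, hx, hx']),
    Finset.card_pair hyy, Finset.card_pair hxx]
  exact ⟨rfl, rfl⟩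

end Relax

namespace Relax

variable {α : Type*}

theorem contract_singleton_indep_iff {N : Matroid α} {x : α} (hx : N.Indep {x}) {I : Set α} :
    (N ／ {x}).Indep I ↔ x ∉ I ∧ N.Indep (insert x I) := by
  rw [hx.contract_indep_iff, disjoint_singleton_right, union_singleton]

theorem insert_insert_erase_sdiff {X : Finset α} {x a a' y y' : α} (hx : x ∈ X)
    (ha : a ∈ X.erase x) (ha' : a' ∈ X.erase x) :
    insert x (insert y (insert y' ((X.erase x : Finset α) \ {a, a'} : Set α))) =
      insert y (insert y' ((X : Set α) \ {a, a'})) := by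
  have h1 := Finset.ne_of_mem_erase ha
  have h2 := Finset.ne_of_mem_erase ha'
  ext e
  simp only [mem_insert_iff, Set.mem_sdiff, Finset.coe_erase, Finset.mem_coe, mem_singleton_iff]
  grind

theorem pairIndep_contract_iff {N : Matroid α} {X Y : Finset α} (hd : Disjoint X Y)
    {x a a' y y' : α} (hi : N.Indep {x}) (hx : x ∈ X) (ha : a ∈ X.erase x) (ha' : a' ∈ X.erase x) (hy : y ∈ Y)
    (hy' : y' ∈ Y) :
    PairIndep (N ／ {x}) (X.erase x) a a' y y' ↔ PairIndep N X a a' y y' := by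
  have hdX : x ∉ Y := Finset.disjoint_left.1 hd hx
  unfold PairIndep
  rw [contract_singleton_indep_iff hi, insert_insert_erase_sdiff hx ha ha']
  have : x ∉ insert y (insert y' ((X.erase x : Finset α) \ {a, a'} : Set α)) := by
    rintro (rfl | rfl | h)
    · exact hdX hy
    · exact hdX hy'
    · simp at h
  simp only [this, not_false_eq_true, true_and]

theorem CHyp.contract {N : Matroid α} {X Y : Finset α} (h : CHyp N X Y) (hd : Disjoint X Y) {x : α}
    (hi : N.Indep {x}) (hx : x ∈ X) : CHyp (N ／ {x}) (X.erase x) Y := by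
  have hdX : x ∉ Y := Finset.disjoint_left.1 hd hx
  constructor
  · rw [contract_singleton_indep_iff hi, Finset.coe_erase, insert_sdiff_singleton,
      insert_eq_of_mem (Finset.mem_coe.2 hx)]
    exact fun hc => h.1 hc.2
  · intro a ha y hy
    rw [hi.contract_isBase_iff, disjoint_singleton_right]
    have hax := Finset.ne_of_mem_erase ha
    refine ⟨?_, ?_⟩
    · convert h.2 a (Finset.mem_of_mem_erase ha) y hy using 1
      ext e
      simp only [mem_insert_iff, Set.mem_sdiff, Finset.coe_erase, Finset.mem_coe, mem_singleton_iff,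
        mem_union]
      grind
    · rintro (rfl | hc)
      · exact hdX hy
      · simp at hc

theorem CHyp.restrict {N : Matroid α} {X Y : Finset α} (h : CHyp N X Y) (hd : Disjoint X Y) {z : α}
    (hE : N.E = (X : Set α) ∪ Y) (hz : z ∈ Y) : CHyp (N ↾ (N.E \ {z})) X (Y.erase z) := by
  have hdY : z ∉ X := Finset.disjoint_right.1 hd hz
  refine ⟨fun hi => h.1 (restrict_indep_iff.1 hi).1, fun x hx y hy => ?_⟩
  refine ((h.2 x hx y (Finset.mem_of_mem_erase hy)).isBasis_ground.isBasis_subset ?_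
    sdiff_subset).isBase_restrict
  rintro e (rfl | he)
  · exact ⟨hE ▸ Or.inr (Finset.mem_of_mem_erase hy), Finset.ne_of_mem_erase hy⟩
  · exact ⟨hE ▸ Or.inl he.1, fun hez => hdY (hez ▸ he.1)⟩

theorem Linked.contract {M M' T : Matroid α} {X Y : Finset α} (h : Linked M M' T X Y) {x x' y : α}
    (hx : x ∈ X) (hx' : x' ∈ X) (hne : x ≠ x') (hy : y ∈ Y) :
    Linked (M ／ {x}) (M' ／ {x}) (T ／ {x}) (X.erase x) Y := by
  have hM := h.cHyp.indep_singleton hx hx' hne hy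
  have hT := h.cHypT.indep_singleton hx hx' hne hy
  have hdX : x ∉ Y := Finset.disjoint_left.1 h.disj hx
  have hM' : M'.Indep {x} := h.indep.subset (by simpa using hx)
  have hg : ((X : Set α) ∪ Y) \ {x} = ((X.erase x : Finset α) : Set α) ∪ Y := by
    ext e
    simp only [Set.mem_sdiff, Finset.coe_erase, Finset.mem_coe, mem_singleton_iff, mem_union]
    grind
  have hX : insert x ((X.erase x : Finset α) : Set α) = X := by simp [hx]
  refine ⟨h.disj.mono_left (Finset.erase_subset _ _), ?_, ?_, ?_, h.rep.contract_indep hM,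
    h.rep'.contract_indep hM', h.repT.contract_indep hT, h.cHyp.contract h.disj hM hx,
    h.cHypT.contract h.disj hT hx, ?_, ?_, ?_⟩
  · rw [contract_ground, h.ground, hg]
  · rw [contract_ground, h.ground', hg]
  · rw [contract_ground, h.groundT, hg]
  · rw [contract_singleton_indep_iff hM', hX]
    exact ⟨by simp, h.indep⟩
  · intro I hI
    rw [contract_singleton_indep_iff hM, contract_singleton_indep_iff hM']
    refine and_congr_right fun hxI => h.agree _ fun hc => hI ?_
    rw [Finset.coe_erase, ← hc, insert_sdiff_of_mem _ (mem_singleton x),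
      sdiff_singleton_eq_self hxI]
  · intro a ha a' ha' y hy y' hy'
    rw [pairIndep_contract_iff h.disj hM hx ha ha' hy hy',
      pairIndep_contract_iff h.disj hT hx ha ha' hy hy']
    exact h.pair a (Finset.mem_of_mem_erase ha) a' (Finset.mem_of_mem_erase ha') y hy y' hy'

theorem Linked.restrict {M M' T : Matroid α} {X Y : Finset α} (h : Linked M M' T X Y) {z : α}
    (hz : z ∈ Y) :
    Linked (M ↾ (M.E \ {z})) (M' ↾ (M'.E \ {z})) (T ↾ (T.E \ {z})) X (Y.erase z) := by
  have hdY : z ∉ X := Finset.disjoint_right.1 h.disj hz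
  have hg : ((X : Set α) ∪ Y) \ {z} = (X : Set α) ∪ (Y.erase z : Finset α) := by
    ext e
    simp only [Set.mem_sdiff, Finset.coe_erase, Finset.mem_coe, mem_singleton_iff, mem_union]
    grind
  have hXg : (X : Set α) ⊆ ((X : Set α) ∪ Y) \ {z} := hg ▸ subset_union_left
  refine ⟨h.disj.mono_right (Finset.erase_subset _ _), ?_, ?_, ?_, h.rep.restrict sdiff_subset,
    h.rep'.restrict sdiff_subset, h.repT.restrict sdiff_subset, h.cHyp.restrict h.disj h.ground hz,
    h.cHypT.restrict h.disj h.groundT hz, ?_, ?_, ?_⟩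
  · rw [restrict_ground_eq, h.ground, hg]
  · rw [restrict_ground_eq, h.ground', hg]
  · rw [restrict_ground_eq, h.groundT, hg]
  · rw [restrict_indep_iff, h.ground']
    exact ⟨h.indep, hXg⟩
  · intro I hI
    rw [restrict_indep_iff, restrict_indep_iff, h.agree I hI, h.ground, h.ground']
  · intro a ha a' ha' y hy y' hy'
    have hs : insert y (insert y' ((X : Set α) \ {a, a'})) ⊆ ((X : Set α) ∪ Y) \ {z} := by
      rw [hg]
      rintro e (rfl | rfl | he)
      · exact Or.inr hy
      · exact Or.inr hy'
      · exact Or.inl he.1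
    have := h.pair a ha a' ha' y (Finset.mem_of_mem_erase hy) y' (Finset.mem_of_mem_erase hy')
    unfold PairIndep at this ⊢
    simpa only [restrict_indep_iff, h.ground, h.groundT, hs, and_true] using this

theorem Linked.indep_compl_iff {M M' T : Matroid α} {X Y : Finset α} (h : Linked M M' T X Y)
    (hX : X.Nonempty) (hY : Y.Nonempty)
    (hag : ∀ I : Set α, I ≠ Y → (M.Indep I ↔ T.Indep I)) : M.Indep Y ↔ T.Indep Y := by
  rcases hX.card_pos.nat_succ_le.eq_or_lt with h1 | h1
  · obtain ⟨x, rfl⟩ := Finset.card_eq_one.1 h1.symm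
    have hb : ∀ N : Matroid α, CHyp N {x} Y → ∀ y ∈ Y, N.IsBase {y} := by
      intro N hN y hy
      simpa using hN.2 x (by simp) y hy
    obtain ⟨y, hy⟩ := hY
    by_cases hY1 : (Y : Set α) = {y}
    · rw [hY1]
      exact iff_of_true (hb M h.cHyp y hy).indep (hb T h.cHypT y hy).indep
    · have hs : ({y} : Set α) ⊆ Y := by simpa using hy
      exact iff_of_false (fun hi => hY1 ((hb M h.cHyp y hy).eq_of_subset_indep hi hs).symm)
        (fun hi => hY1 ((hb T h.cHypT y hy).eq_of_subset_indep hi hs).symm)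
  by_cases h2 : X.card = 2 ∧ Y.card = 2
  · obtain ⟨x, x', hne, rfl⟩ := Finset.card_eq_two.1 h2.1
    obtain ⟨y, y', hne', rfl⟩ := Finset.card_eq_two.1 h2.2
    have := h.pair x (by simp) x' (by simp) y (by simp) y' (by simp)
    simpa [PairIndep, hne, hne'] using this
  · exact ⟨h.ternary_indep_compl h1 hY h2 hag, h.indep_compl_of_ternary h1 hY hag⟩

theorem Linked.indep_iff {M M' T : Matroid α} {X Y : Finset α} (h : Linked M M' T X Y)
    (hX : X.Nonempty) (hY : Y.Nonempty) (I : Set α) : M.Indep I ↔ T.Indep I := by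
  induction hn : X.card + Y.card using Nat.strong_induction_on generalizing M M' T X Y I with
  | _ n ih =>
  subst hn
  have hag : ∀ J : Set α, J ≠ Y → (M.Indep J ↔ T.Indep J) := by
    intro J hJY
    by_cases hJE : J ⊆ (X : Set α) ∪ Y
    swap
    · exact iff_of_false (fun hi => hJE (h.ground ▸ hi.subset_ground))
        (fun hi => hJE (h.groundT ▸ hi.subset_ground))
    by_cases hJX : J ⊆ X
    · rw [h.cHyp.indep_iff_of_subset hY hJX, h.cHypT.indep_iff_of_subset hY hJX]
    obtain ⟨y, hyJ, hyX⟩ := not_subset.1 hJX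
    have hy : y ∈ Y := (hJE hyJ).resolve_left hyX
    by_cases hXJ : (X : Set α) ⊆ J
    · exact iff_of_false (fun hi => h.cHyp.1 (hi.subset hXJ))
        (fun hi => h.cHypT.1 (hi.subset hXJ))
    obtain ⟨x', hx', hx'J⟩ := not_subset.1 hXJ
    by_cases hx : ∃ x ∈ X, x ∈ J
    · obtain ⟨x, hx, hxJ⟩ := hx
      have hne : x ≠ x' := fun hxx => hx'J (hxx ▸ hxJ)
      have hcard := Finset.card_erase_lt_of_mem hx
      have := ih _ (by omega) (h.contract hx hx' hne hy) ⟨x', Finset.mem_erase.2 ⟨hne.symm, hx'⟩⟩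
        hY (J \ {x}) rfl
      rw [contract_singleton_indep_iff (h.cHyp.indep_singleton hx hx' hne hy),
        contract_singleton_indep_iff (h.cHypT.indep_singleton hx hx' hne hy),
        insert_sdiff_singleton, insert_eq_of_mem hxJ] at this
      simpa using this
    · have hJsub : J ⊆ Y := fun e he => (hJE he).resolve_left fun hex => hx ⟨e, hex, he⟩
      obtain ⟨z, hz, hzJ⟩ := exists_of_ssubset (hJsub.ssubset_of_ne hJY)
      have hcard := Finset.card_erase_lt_of_mem hz
      have := ih _ (by omega) (h.restrict hz) hX
        ⟨y, Finset.mem_erase.2 ⟨fun hyz => hzJ (hyz ▸ hyJ), hy⟩⟩ J rfl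
      have hs : J ⊆ ((X : Set α) ∪ Y) \ {z} := subset_sdiff_singleton hJE hzJ
      simpa only [restrict_indep_iff, h.ground, h.groundT, hs, and_true] using this
  by_cases hI : I = Y
  · rw [hI]
    exact h.indep_compl_iff hX hY hag
  · exact hag I hI

end Relax

namespace Relax

variable {α : Type*}

theorem CircuitHyperplane.isCircuit {M : Matroid α} {X : Set α} (h : CircuitHyperplane M X) :
    M.IsCircuit X :=
  isCircuit_iff_forall_ssubset.2 ⟨h.1.1, fun I hI => h.1.2 I hI⟩

theorem CircuitHyperplane.cHyp {M : Matroid α} {X Y : Finset α} (h : CircuitHyperplane M X)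
    (hE : M.E = (X : Set α) ∪ Y) (hd : Disjoint X Y) : CHyp M X Y := by
  refine ⟨h.1.1.not_indep, fun x hx y hy => ?_⟩
  have hC := h.isCircuit
  obtain ⟨hfl, -, hmax⟩ := h.2
  have hyX : y ∉ (X : Set α) := Finset.disjoint_right.1 hd hy
  have hi : M.Indep ((X : Set α) \ {x}) := hC.sdiff_singleton_indep hx
  have hcl : M.closure ((X : Set α) \ {x}) = X := by
    rw [hC.closure_sdiff_singleton_eq, hfl.closure]
  have hyE : y ∈ M.E := hE ▸ Or.inr hy
  refine isBase_iff_indep_closure_eq.2 ⟨?_, ?_⟩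
  · rw [hi.insert_indep_iff_of_notMem (fun h => hyX h.1), hcl]
    exact ⟨hyE, hyX⟩
  · refine hmax _ (M.isFlat_closure _) ?_
    refine ssubset_of_subset_of_ne ?_ fun heq => hyX ?_
    · conv_lhs => rw [← hcl]
      exact M.closure_subset_closure (subset_insert _ _)
    · rw [heq]
      exact M.mem_closure_of_mem' (mem_insert _ _) hyE

theorem IsRelaxation.indep_iff {M M' : Matroid α} {X I : Set α} (h : IsRelaxation M M' X)
    (hI : I ≠ X) : M.Indep I ↔ M'.Indep I := by
  constructor
  · intro hi
    obtain ⟨B, hB, hIB⟩ := hi.exists_isBase_superset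
    exact ((h.2.2 B).2 (Or.inl hB)).indep.subset hIB
  · intro hi
    obtain ⟨B, hB, hIB⟩ := hi.exists_isBase_superset
    rcases (h.2.2 B).1 hB with hB | rfl
    · exact hB.indep.subset hIB
    · exact h.1.1.2 I (hIB.ssubset_of_ne hI)

theorem IsRelaxation.isBase {M M' : Matroid α} {X : Set α} (h : IsRelaxation M M' X) :
    M'.IsBase X :=
  (h.2.2 X).2 (Or.inr rfl)

theorem IsRelaxation.fullBase {M M' : Matroid α} {X Y : Finset α} (h : IsRelaxation M M' X)
    (hE : M.E = (X : Set α) ∪ Y) (hd : Disjoint X Y) : FullBase M' X Y := by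
  refine ⟨h.isBase.indep, fun y hy => ⟨?_, fun x hx => ?_⟩⟩
  · exact fun hi => Finset.disjoint_right.1 hd hy (h.isBase.mem_of_insert_indep hi)
  · exact ((h.2.2 _).2 (Or.inl ((h.1.cHyp hE hd).2 x hx y hy))).indep

theorem IsRelaxation.pairIndep_iff {M M' : Matroid α} {X Y : Finset α} (h : IsRelaxation M M' X)
    (hd : Disjoint X Y) {x x' y y' : α} (hy : y ∈ Y) :
    PairIndep M X x x' y y' ↔ PairIndep M' X x x' y y' := by
  unfold PairIndep
  rw [h.indep_iff]
  intro heq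
  have : y ∈ (X : Set α) := heq ▸ mem_insert _ _
  exact Finset.disjoint_right.1 hd hy this

/-- A matroid over `GF4` with a circuit-hyperplane whose relaxation is also representable over
`GF4` is ternary. -/
theorem IsRelaxation.hasRelationSpace_zmod_three {M M' : Matroid α} {X Y : Finset α}
    (h : IsRelaxation M M' X) (hE : M.E = (X : Set α) ∪ Y) (hd : Disjoint X Y) (hX : X.Nonempty)
    (hY : Y.Nonempty) (hM : HasRelationSpace M GF4) (hM' : HasRelationSpace M' GF4) :
    HasRelationSpace M (ZMod 3) := by
  have hE' : M'.E = (X : Set α) ∪ Y := h.2.1.trans hE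
  obtain ⟨P, hP, hPM⟩ := exists_mulRep hE' hd hM' (h.fullBase hE hd)
  obtain ⟨l, hl⟩ := exists_isLog
  obtain ⟨T, hTE, hT⟩ := exists_matroid_addRep X Y fun x y => l (P x y)
  have hTR := hT.hasRelationSpace hTE
  have hlink : Linked M M' T X Y := by
    refine ⟨hd, hE, hE', hTE, hM, hM', hTR, h.1.cHyp hE hd, hT.cHyp hTE hd hX, h.isBase.indep,
      fun I hI => h.indep_iff hI, ?_⟩
    intro x hx x' hx' y hy y' hy'
    rw [h.pairIndep_iff hd hy, hPM.pairIndep_iff hd hP hx hx' hy hy',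
      hT.pairIndep_iff hd hx hx' hy hy', not_iff_not]
    exact hl.mul_eq_mul_iff (hP _ hx _ hy) (hP _ hx' _ hy') (hP _ hx _ hy') (hP _ hx' _ hy)
  have : M = T := ext_indep (hE.trans hTE.symm) fun I _ => hlink.indep_iff hX hY I
  exact this ▸ hTR

end Relax

namespace Relax

variable {α F : Type*} [Field F]

theorem IsRelaxation.delete_eq {M M' : Matroid α} {X : Set α} (h : IsRelaxation M M' X) {a : α}
    (ha : a ∈ X) : delete M' {a} = delete M {a} := by
  unfold delete
  rw [h.2.1]
  refine ext_indep rfl fun I hI => ?_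
  rw [restrict_indep_iff, restrict_indep_iff, h.indep_iff]
  rintro rfl
  exact (hI ha).2 rfl

theorem IsRelaxation.contract_eq {M M' : Matroid α} {X : Set α} (h : IsRelaxation M M' X) {a : α}
    (ha : a ∉ X) (hi : M.Indep {a}) : contract M' {a} = contract M {a} := by
  have hne : ∀ I : Set α, insert a I ≠ X := fun I hI => ha (hI ▸ mem_insert a I)
  have hi' : M'.Indep {a} := by
    rwa [← h.indep_iff]
    simpa using hne ∅
  change M' ／ {a} = M ／ {a}
  refine ext_indep (by rw [contract_ground, contract_ground, h.2.1]) fun I _ => ?_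
  rw [contract_singleton_indep_iff hi, contract_singleton_indep_iff hi', h.indep_iff (hne I)]

theorem AddRep.pair_dep {N : Matroid α} {X Y : Finset α} (hd : Disjoint X Y) {q : α → α → F}
    (h : AddRep N X Y q) {y y' : α} (hy : y ∈ Y) (hy' : y' ∈ Y) (hne : y ≠ y') {k : F}
    (hk : ∀ x ∈ X, q x y - q x y' = k) : ¬ N.Indep {y, y'} := by
  have hs : ({y, y'} : Set α) ⊆ X ∪ Y := by
    rintro e (rfl | rfl)
    · exact Or.inr hy
    · exact Or.inr hy'
  rw [h _ hs]
  intro hw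
  have hsum : ∀ f : α → F,
      ∑ z ∈ Y, (if z = y then 1 else if z = y' then -1 else 0) * f z = f y - f y' := by
    intro f
    rw [sum_mul_eq_two hy hy' hne]
    · simp [hne.symm, sub_eq_add_neg]
    · intro z _ h1 h2
      simp [h1, h2]
  have := hw (fun z => if z = y then 1 else if z = y' then -1 else 0) k ?_ ?_ ?_
  · simpa using congrFun this y
  · intro e he
    simp only [mem_insert_iff, mem_singleton_iff, not_or] at he
    simp [he.1, he.2]
  · simpa using hsum 1
  · intro x hx
    have h1 : x ≠ y := fun h => Finset.disjoint_left.1 hd hx (h ▸ hy)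
    have h2 : x ≠ y' := fun h => Finset.disjoint_left.1 hd hx (h ▸ hy')
    rw [hsum (q x), hk x hx]
    simp [h1, h2]

theorem Connected.exists_pairIndep {M : Matroid α} (hconn : Connected M) {X Y : Finset α}
    (hE : M.E = (X : Set α) ∪ Y) (hd : Disjoint X Y) (hX : X.Nonempty) (hY : Y.Nonempty)
    (hM : HasRelationSpace M F) (hC : CHyp M X Y) :
    ∃ x ∈ X, ∃ x' ∈ X, ∃ y ∈ Y, ∃ y' ∈ Y, PairIndep M X x x' y y' := by
  by_contra! hcon
  obtain ⟨q, hq⟩ := exists_addRep hE hd hX hY hM hC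
  obtain ⟨x, hx⟩ := hX
  obtain ⟨y, hy⟩ := hY
  have hdX : ∀ e ∈ X, e ∉ Y := fun e he heY => Finset.disjoint_left.1 hd he heY
  obtain ⟨K, hK, hxK, hyK⟩ := hconn x (hE ▸ Or.inl hx) y (hE ▸ Or.inr hy)
    (fun h => hdX x hx (h ▸ hy))
  have hKY : ∀ y' ∈ Y, y' ∈ K → y' = y := by
    intro y' hy' hy'K
    by_contra hne
    refine hq.pair_dep hd hy' hy hne (k := q x y' - q x y) ?_ (hK.2 _ ?_)
    · intro x' hx'
      have := hcon x hx x' hx' y' hy' y hy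
      rw [hq.pairIndep_iff hd hx hx' hy' hy, not_not] at this
      linear_combination -this
    · refine ssubset_of_subset_of_ne (by simp [insert_subset_iff, hyK, hy'K]) ?_
      rintro rfl
      rcases hxK with rfl | rfl
      · exact hdX _ hx hy'
      · exact hdX _ hx hy
  have hXK : ¬ (X : Set α) ⊆ K := fun hs =>
    hC.1 (hK.2 _ (hs.ssubset_of_ne fun heq => hdX y (by rw [← heq] at hyK; exact hyK) hy))
  obtain ⟨x', hx', hx'K⟩ := not_subset.1 hXK
  refine hK.1.not_indep ((hC.2 x' hx' y hy).indep.subset fun e he => ?_)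
  rcases (hE ▸ hK.1.subset_ground he : e ∈ (X : Set α) ∪ Y) with heX | heY
  · exact Or.inr ⟨heX, fun h => hx'K (h ▸ he)⟩
  · exact Or.inl (hKY e heY he)

/-- If no matroid representable over `F` has property `Q`, then relaxing a circuit-hyperplane of an
`F`-representable matroid leaves `Q` failing for the deletion of any element of the new basis and
the contraction of any other element. -/
theorem IsRelaxation.not_minor {M M' : Matroid α} {X Y : Finset α} (h : IsRelaxation M M' X)
    (hE : M.E = (X : Set α) ∪ Y) (hd : Disjoint X Y) (hX : X.Nonempty) (hM : HasRelationSpace M F)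
    {Q : Matroid α → Prop} (hQ : ∀ N : Matroid α, HasRelationSpace N F → ¬ Q N) :
    (∀ a ∈ M'.E, ¬ (Q (delete M' {a}) ∧ Q (contract M' {a}))) ∧ M'.IsBase X ∧
      (∀ a ∈ (X : Set α), ¬ Q (delete M' {a})) ∧ ∀ a ∈ M'.E \ X, ¬ Q (contract M' {a}) := by
  have hdel : ∀ a ∈ (X : Set α), ¬ Q (delete M' {a}) := by
    intro a ha
    rw [h.delete_eq ha]
    exact hQ _ (hM.restrict sdiff_subset)
  have hcon : ∀ a ∈ M'.E \ X, ¬ Q (contract M' {a}) := by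
    rintro a ⟨haE, haX⟩
    rw [h.2.1, hE] at haE
    obtain ⟨x, hx⟩ := hX
    have ha : M.Indep {a} := ((h.1.cHyp hE hd).2 x hx a (haE.resolve_left haX)).indep.subset
      (by simp)
    rw [h.contract_eq haX ha]
    exact hQ _ (hM.contract_indep ha)
  refine ⟨fun a ha hQa => ?_, h.isBase, hdel, hcon⟩
  by_cases haX : a ∈ (X : Set α)
  · exact hdel a haX hQa.1
  · exact hcon a ⟨ha, haX⟩ hQa.2

end Relax

namespace Relax

variable {α : Type*}

theorem PairIndep.symm_left {N : Matroid α} {X : Finset α} {x x' y y' : α}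
    (h : PairIndep N X x x' y y') : PairIndep N X x' x y y' :=
  ⟨h.1.symm, h.2.1, by rw [pair_comm]; exact h.2.2⟩

theorem PairIndep.symm_right {N : Matroid α} {X : Finset α} {x x' y y' : α}
    (h : PairIndep N X x x' y y') : PairIndep N X x x' y' y :=
  ⟨h.1, h.2.1.symm, by rw [insert_comm]; exact h.2.2⟩

theorem FullBase.hasUnifMinor_two_four {N : Matroid α} {X Y : Finset α}
    (hE : N.E = (X : Set α) ∪ Y) (hd : Disjoint X Y) (h : FullBase N X Y) {x x' y y' : α}
    (hx : x ∈ X) (hx' : x' ∈ X) (hy : y ∈ Y) (hy' : y' ∈ Y) (hp : PairIndep N X x x' y y') :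
    HasUnifMinor N 2 4 := by
  have := h.hasUnifMinor (B₀ := {x, x'}) (Y₀ := {y, y'}) hE hd
    (by simp [Finset.insert_subset_iff, hx, hx']) (by simp [Finset.insert_subset_iff, hy, hy'])
    (Or.inl Finset.card_le_two) ?_
  · rwa [Finset.card_pair hp.1, Finset.card_pair hp.2.1] at this
  · intro b hb b' hb' z hz z' hz' hbb hzz
    refine (?_ : PairIndep N X b b' z z').2.2
    simp only [Finset.mem_insert, Finset.mem_singleton] at hb hb' hz hz'
    rcases hb with rfl | rfl <;> rcases hb' with rfl | rfl <;> rcases hz with rfl | rfl <;>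
      rcases hz' with rfl | rfl <;>
      first
      | exact absurd rfl hbb
      | exact absurd rfl hzz
      | exact hp
      | exact hp.symm_left
      | exact hp.symm_right
      | exact hp.symm_left.symm_right

theorem FullBase.hasU25U35Minor {N : Matroid α} {X Y : Finset α}
    (hE : N.E = (X : Set α) ∪ Y) (hd : Disjoint X Y) (h : FullBase N X Y) (h2 : ¬ TwoValued N X Y) :
    HasU25U35Minor N := by
  unfold TwoValued at h2
  rw [not_and_or] at h2
  push Not at h2
  rcases h2 with ⟨x, hx, x', hx', y₁, hy₁, y₂, hy₂, y₃, hy₃, h12, h13, h23⟩ |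
    ⟨x₁, hx₁, x₂, hx₂, x₃, hx₃, y, hy, y', hy', h12, h13, h23⟩
  · left
    have := h.hasUnifMinor (B₀ := {x, x'}) (Y₀ := {y₁, y₂, y₃}) hE hd
      (by simp [Finset.insert_subset_iff, hx, hx'])
      (by simp [Finset.insert_subset_iff, hy₁, hy₂, hy₃]) (Or.inl Finset.card_le_two) ?_
    · rwa [Finset.card_pair h12.1,
        Finset.card_eq_three.2 ⟨y₁, y₂, y₃, h12.2.1, h13.2.1, h23.2.1, rfl⟩] at this
    · intro b hb b' hb' z hz z' hz' hbb hzz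
      refine (?_ : PairIndep N X b b' z z').2.2
      simp only [Finset.mem_insert, Finset.mem_singleton] at hb hb' hz hz'
      have key : PairIndep N X x x' z z' := by
        rcases hz with rfl | rfl | rfl <;> rcases hz' with rfl | rfl | rfl <;>
          first
          | exact absurd rfl hzz
          | assumption
          | (apply PairIndep.symm_right; assumption)
      rcases hb with rfl | rfl <;> rcases hb' with rfl | rfl <;>
        first
        | exact absurd rfl hbb
        | exact key
        | exact key.symm_left
  · right
    have := h.hasUnifMinor (B₀ := {x₁, x₂, x₃}) (Y₀ := {y, y'}) hE hd
      (by simp [Finset.insert_subset_iff, hx₁, hx₂, hx₃])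
      (by simp [Finset.insert_subset_iff, hy, hy']) (Or.inr Finset.card_le_two) ?_
    · rwa [Finset.card_pair h12.2.1,
        Finset.card_eq_three.2 ⟨x₁, x₂, x₃, h12.1, h13.1, h23.1, rfl⟩] at this
    · intro b hb b' hb' z hz z' hz' hbb hzz
      refine (?_ : PairIndep N X b b' z z').2.2
      simp only [Finset.mem_insert, Finset.mem_singleton] at hb hb' hz hz'
      have key : PairIndep N X b b' y y' := by
        rcases hb with rfl | rfl | rfl <;> rcases hb' with rfl | rfl | rfl <;>
          first
          | exact absurd rfl hbb
          | assumption
          | (apply PairIndep.symm_left; assumption)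
      rcases hz with rfl | rfl <;> rcases hz' with rfl | rfl <;>
        first
        | exact absurd rfl hzz
        | exact key
        | exact key.symm_right

theorem IsRelaxation.twoValued_iff {M M' : Matroid α} {X Y : Finset α} (h : IsRelaxation M M' X)
    (hd : Disjoint X Y) : TwoValued M X Y ↔ TwoValued M' X Y := by
  unfold TwoValued
  refine and_congr ?_ ?_
  · refine forall₂_congr fun x _ => forall₂_congr fun x' _ => forall₂_congr fun y₁ hy₁ =>
      forall₂_congr fun y₂ hy₂ => forall₂_congr fun y₃ _ => ?_
    rw [h.pairIndep_iff hd hy₁, h.pairIndep_iff hd hy₁, h.pairIndep_iff hd hy₂]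
  · refine forall₂_congr fun x _ => forall₂_congr fun x' _ => forall₂_congr fun x'' _ =>
      forall₂_congr fun y hy => forall₂_congr fun y' _ => ?_
    rw [h.pairIndep_iff hd hy, h.pairIndep_iff hd hy, h.pairIndep_iff hd hy]

end Relax

/-- Let `M` and `M'` be GF(4)-representable (finite) matroids such that `M`
is connected, `M'` is 3-connected, and `M'` is obtained from `M` by relaxing a
circuit-hyperplane `X`. Then `M'` is either `U_{2,4}`-fragile or `{U_{2,5}, U_{3,5}}`-fragile;
moreover, `X` is a basis of `M'` every element of which is nondeletable, and every element
of `E(M') − X` is noncontractible. -/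
theorem statement6 {α : Type*} (M M' : Matroid α) (X : Set α)
    (hfin : M.E.Finite)
    (hrepM : Relax.Representable M Relax.GF4)
    (hrepM' : Relax.Representable M' Relax.GF4)
    (hconn : Relax.Connected M) (h3c : Relax.ThreeConnected M')
    (hrel : Relax.IsRelaxation M M' X) :
    (Relax.FragileU24 M' ∧ M'.IsBase X ∧
        (∀ a ∈ X, ¬ Relax.HasUnifMinor (Relax.delete M' {a}) 2 4) ∧
        (∀ a ∈ M'.E \ X, ¬ Relax.HasUnifMinor (Relax.contract M' {a}) 2 4)) ∨
      (Relax.FragileU25U35 M' ∧ M'.IsBase X ∧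
        (∀ a ∈ X, ¬ Relax.HasU25U35Minor (Relax.delete M' {a})) ∧
        (∀ a ∈ M'.E \ X, ¬ Relax.HasU25U35Minor (Relax.contract M' {a}))) := by
  have hXE : X ⊆ M.E := hrel.1.1.1.subset_ground
  lift X to Finset α using hfin.subset hXE
  obtain ⟨Y, hY⟩ := (hfin.subset (sdiff_subset (t := (X : Set α)))).exists_finset_coe
  have hE : M.E = (X : Set α) ∪ Y := by rw [hY, union_sdiff_cancel hXE]
  have hd : Disjoint X Y := by
    rw [← Finset.disjoint_coe, hY]
    exact disjoint_sdiff_right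
  have hXn : X.Nonempty := Finset.coe_nonempty.1 hrel.1.1.1.nonempty
  have hYn : Y.Nonempty := by
    rw [← Finset.coe_nonempty, hY]
    exact sdiff_nonempty.2 fun h => hrel.1.2.2.1 (hXE.antisymm h)
  have hM := Relax.hasRelationSpace_of_representable hfin hrepM
  have hM' := Relax.hasRelationSpace_of_representable (hrel.2.1 ▸ hfin) hrepM'
  have hB := hrel.fullBase hE hd
  have hE' : M'.E = (X : Set α) ∪ Y := hrel.2.1.trans hE
  by_cases h2 : Relax.TwoValued M X Y
  · left
    obtain ⟨x, hx, x', hx', y, hy, y', hy', hp⟩ :=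
      hconn.exists_pairIndep hE hd hXn hYn hM (hrel.1.cHyp hE hd)
    obtain ⟨q, hq⟩ := Relax.exists_addRep hE hd hXn hYn hM (hrel.1.cHyp hE hd)
    obtain ⟨p, hp₂⟩ := h2.addRep_zmod hd hq hx hy
    obtain ⟨h₁, h₂⟩ := hrel.not_minor hE hd hXn (hp₂.hasRelationSpace hE)
      (Q := fun N => Relax.HasUnifMinor N 2 4)
      fun N hN => Relax.not_hasUnifMinor (by simp) (Or.inl rfl) hN
    exact ⟨⟨hB.hasUnifMinor_two_four hE' hd hx hx' hy hy' ((hrel.pairIndep_iff hd hy).1 hp), h₁⟩,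
      h₂⟩
  · right
    obtain ⟨h₁, h₂⟩ := hrel.not_minor hE hd hXn
      (hrel.hasRelationSpace_zmod_three hE hd hXn hYn hM hM') (Q := Relax.HasU25U35Minor)
      fun N hN => not_or.2 ⟨Relax.not_hasUnifMinor (by simp) (Or.inl rfl) hN,
        Relax.not_hasUnifMinor (by simp) (Or.inr rfl) hN⟩
    exact ⟨⟨hB.hasU25U35Minor hE' hd fun h => h2 ((hrel.twoValued_iff hd).2 h), h₁⟩, h₂⟩
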